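/- arXiv:2303.01252 — 7 statements merged into one kernel-verified Lean document; each statement's English description precedes it below -/
import Mathlib

section
/- Let A ∈ M_m(ℂ) with eigenvalues λ_1, ..., λ_m counted with multiplicity. Then for every 0 ≤ p < ∞, ∑_{i=1}^m |λ_i|^p ≤ tr(|A|^p). -/
open Filter Matrix Polynomial

/-- `absPow T p` is the matrix `|T|^p = (TᴴT)^{p/2}`, the `p`-th power (by functional
calculus) of the positive-semidefinite square root `|T| := √(TᴴT)`. -/
noncomputable def absPow {m : ℕ} (T : Matrix (Fin m) (Fin m) ℂ) (p : ℝ) :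
    Matrix (Fin m) (Fin m) ℂ :=
  cfc (fun x : ℝ => x ^ (p / 2)) (Tᴴ * T)

section

open scoped ComplexOrder

/-- Schur triangularization of a complex square matrix. -/
theorem exists_unitary_isUpperTriangular (n : ℕ) (A : Matrix (Fin n) (Fin n) ℂ) :
    ∃ U ∈ Matrix.unitaryGroup (Fin n) ℂ, (Uᴴ * A * U).IsUpperTriangular := by
  induction n with
  | zero => exact ⟨1, one_mem _, fun i => i.elim0⟩
  | succ n ih =>
    obtain ⟨c, hc⟩ := Module.End.exists_eigenvalue (Matrix.toEuclideanLin A)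
    obtain ⟨v, hv⟩ := hc.exists_hasEigenvector
    have hv0 : ‖v‖ ≠ 0 := norm_ne_zero_iff.2 hv.2
    let w : EuclideanSpace ℂ (Fin (n + 1)) := ((‖v‖ : ℂ)⁻¹) • v
    have hw : ‖w‖ = 1 := by simp [w, norm_smul, hv0]
    have hAw : Matrix.toEuclideanLin A w = c • w := by
      simp only [w, map_smul, hv.apply_eq_smul, smul_comm c]
    obtain ⟨b, hb⟩ := Orthonormal.exists_orthonormalBasis_extension_of_card_eq (𝕜 := ℂ)
      (E := EuclideanSpace ℂ (Fin (n + 1))) (ι := Fin (n + 1)) (by simp)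
      (v := fun _ => w) (s := {0}) ⟨fun i => by simpa using hw, fun i j hij =>
        (hij (Subsingleton.elim i j)).elim⟩
    have hb0 : b 0 = w := hb 0 rfl
    let P : Matrix (Fin (n + 1)) (Fin (n + 1)) ℂ := fun i j => b j i
    have hP : Pᴴ * P = 1 :=
      Matrix.mem_unitaryGroup_iff'.1
        ((EuclideanSpace.basisFun _ ℂ).toMatrix_orthonormalBasis_mem_unitary b)
    have hcol : ∀ i, (A * P) i 0 = c * P i 0 := fun i => by
      have := congrArg (fun x : EuclideanSpace ℂ (Fin (n + 1)) => x i) hAw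
      rw [Matrix.mul_apply]
      simpa [P, hb0, Matrix.mulVec, dotProduct] using this
    have hB : ∀ i : Fin n, (Pᴴ * A * P) i.succ 0 = 0 := fun i => by
      have h1 := congrFun (congrFun hP i.succ) 0
      rw [Matrix.mul_apply] at h1
      rw [Matrix.mul_assoc, Matrix.mul_apply]
      simp_rw [hcol, mul_left_comm _ c]
      rw [← Finset.mul_sum, h1]
      simp
    set B := Pᴴ * A * P with hBdef
    obtain ⟨V, hV, hT⟩ := ih (B.submatrix Fin.succ Fin.succ)
    let Q : Matrix (Fin (n + 1)) (Fin (n + 1)) ℂ :=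
      Matrix.of (Fin.cons (Fin.cons 1 0) fun i => Fin.cons 0 (V i))
    have hVV := Matrix.mem_unitaryGroup_iff'.1 hV
    have hQ : Qᴴ * Q = 1 := by
      ext i j
      refine Fin.cases ?_ (fun i => ?_) i <;> refine Fin.cases ?_ (fun j => ?_) j <;>
        simp [Q, Matrix.mul_apply, Fin.sum_univ_succ, Matrix.one_apply]
      · exact fun h => (Fin.succ_ne_zero _ h.symm).elim
      · simpa [Matrix.mul_apply, Matrix.one_apply] using congrFun (congrFun hVV i) j
    refine ⟨P * Q, mul_mem (Matrix.mem_unitaryGroup_iff'.2 hP)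
      (Matrix.mem_unitaryGroup_iff'.2 hQ), ?_⟩
    have hPQ : (P * Q)ᴴ * A * (P * Q) = Qᴴ * (B * Q) := by
      simp only [hBdef, Matrix.conjTranspose_mul, Matrix.mul_assoc]
    rw [hPQ]
    intro i j
    refine Fin.cases ?_ (fun i => ?_) i
    · intro h
      exact (Fin.not_lt_zero _ h).elim
    · refine Fin.cases ?_ (fun j => ?_) j
      · intro _
        simp [Q, Matrix.mul_apply, Fin.sum_univ_succ, hB]
      · intro h
        have := hT (show j < i from Fin.succ_lt_succ_iff.1 h)
        rw [Matrix.mul_assoc] at this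
        simpa [Q, Matrix.mul_apply, Fin.sum_univ_succ, hB] using this

/-- A diagonal entry of `BᴴB` is the squared norm of a column of `B`, hence dominates the squared
norm of the diagonal entry of `B`. -/
theorem norm_sq_diag_le_re_conjTranspose_mul_self {n : ℕ} (B : Matrix (Fin n) (Fin n) ℂ)
    (i : Fin n) : ‖B i i‖ ^ 2 ≤ ((Bᴴ * B) i i).re := by
  have h : ((Bᴴ * B) i i).re = ∑ j, ‖B j i‖ ^ 2 := by
    rw [Matrix.mul_apply, Complex.re_sum]
    refine Finset.sum_congr rfl fun j _ => ?_
    rw [Matrix.conjTranspose_apply, RCLike.star_def, RCLike.conj_mul]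
    norm_cast
  rw [h]
  exact Finset.single_le_sum (f := fun j => ‖B j i‖ ^ 2) (fun j _ => by positivity)
    (Finset.mem_univ i)

/-- If `K` dominates both the identity and `t • TᴴT` with `T` upper triangular, then its determinant
dominates the product of the numbers `max 1 (t * ‖T i i‖ ^ 2)`. -/
theorem prod_max_norm_sq_diag_le_re_det {n : ℕ} {T K : Matrix (Fin n) (Fin n) ℂ}
    (hT : T.IsUpperTriangular) {t : ℝ} (ht : 0 ≤ t) (hK : K.PosDef)
    (hK1 : (K - 1).PosSemidef) (hKT : (K - (t : ℂ) • (Tᴴ * T)).PosSemidef) :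
    ∏ i, max 1 (t * ‖T i i‖ ^ 2) ≤ K.det.re := by
  set M := LDL.lowerInv hK
  set d := LDL.diagEntries hK
  have hD : Matrix.diagonal d = M * K * Mᴴ := LDL.diag_eq_lowerInv_conj hK
  have hlow : M.IsLowerTriangular := fun i j h => LDL.lowerInv_triangular hK h
  have hup : Mᴴ.IsUpperTriangular := fun i j h => by
    rw [Matrix.conjTranspose_apply, show M j i = 0 from hlow h, star_zero]
  have hdet : M.det = ∏ i, M i i := Matrix.det_of_isLowerTriangular _ hlow
  have hM0 : M.det ≠ 0 := (Matrix.isUnit_det_of_invertible M).ne_zero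
  have hdi : ∀ i, d i = (M * K * Mᴴ) i i := fun i => by rw [← hD, Matrix.diagonal_apply_eq]
  have hpd : (M * K * Mᴴ).PosSemidef := hK.posSemidef.mul_mul_conjTranspose_same M
  have hdre : ∀ i, d i = ((d i).re : ℂ) := fun i => by
    have := hpd.diag_nonneg (i := i)
    rw [← hdi] at this
    exact Complex.eq_re_of_ofReal_le this
  have hle : ∀ i, ‖M i i‖ ^ 2 * max 1 (t * ‖T i i‖ ^ 2) ≤ (d i).re := fun i => by
    have hone : ‖M i i‖ ^ 2 ≤ (d i).re := by
      have h1 := (hK1.mul_mul_conjTranspose_same M).diag_nonneg (i := i)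
      have h2 := norm_sq_diag_le_re_conjTranspose_mul_self Mᴴ i
      rw [Matrix.mul_sub, Matrix.sub_mul, Matrix.sub_apply, ← hdi, Matrix.mul_one] at h1
      have h3 := (Complex.le_def.1 h1).1
      simp only [Matrix.conjTranspose_conjTranspose, Matrix.conjTranspose_apply,
        norm_star, Complex.sub_re, Complex.zero_re] at h2 h3
      linarith
    have htwo : t * (‖T i i‖ ^ 2 * ‖M i i‖ ^ 2) ≤ (d i).re := by
      have h1 := (hKT.mul_mul_conjTranspose_same M).diag_nonneg (i := i)
      have h2 := norm_sq_diag_le_re_conjTranspose_mul_self (T * Mᴴ) i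
      have h4 : (T * Mᴴ) i i = T i i * star (M i i) := by
        rw [Matrix.mul_apply, Finset.sum_eq_single i]
        · rfl
        · intro j _ hj
          rcases lt_or_gt_of_ne hj with h | h
          · rw [hT h, zero_mul]
          · rw [hup h, mul_zero]
        · simp
      have h5 : M * ((t : ℂ) • (Tᴴ * T)) * Mᴴ = (t : ℂ) • ((T * Mᴴ)ᴴ * (T * Mᴴ)) := by
        simp [Matrix.mul_assoc, Matrix.conjTranspose_mul]
      rw [Matrix.mul_sub, Matrix.sub_mul, Matrix.sub_apply, ← hdi, h5, Matrix.smul_apply,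
        smul_eq_mul] at h1
      have h3 := (Complex.le_def.1 h1).1
      rw [Complex.sub_re, Complex.re_ofReal_mul, Complex.zero_re] at h3
      rw [h4, norm_mul, norm_star, mul_pow] at h2
      nlinarith [mul_le_mul_of_nonneg_left h2 ht]
    rcases max_cases 1 (t * ‖T i i‖ ^ 2) with ⟨h, _⟩ | ⟨h, _⟩ <;> rw [h] <;> nlinarith
  have hprod := Finset.prod_le_prod (s := Finset.univ) (fun i _ => by positivity)
    (fun i _ => hle i)
  rw [Finset.prod_mul_distrib] at hprod
  have h6 : ∏ i, ‖M i i‖ ^ 2 = ‖M.det‖ ^ 2 := by rw [hdet, norm_prod, Finset.prod_pow]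
  have h7 : ∏ i, (d i).re = ‖M.det‖ ^ 2 * K.det.re := by
    have h8 := congrArg Matrix.det hD
    rw [Matrix.det_diagonal, Matrix.det_mul, Matrix.det_mul, Matrix.det_conjTranspose,
      mul_right_comm, RCLike.star_def, RCLike.mul_conj, Finset.prod_congr rfl fun i _ => hdre i]
      at h8
    have h9 := congrArg Complex.re h8
    have h10 : ((‖M.det‖ : ℂ)) ^ 2 = ((‖M.det‖ ^ 2 : ℝ) : ℂ) := by push_cast; rfl
    rw [← Complex.ofReal_prod, Complex.ofReal_re] at h9
    rw [h9]
    change (((‖M.det‖ : ℂ)) ^ 2 * _).re = _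
    rw [h10, Complex.re_ofReal_mul]
  rw [h6, h7] at hprod
  exact le_of_mul_le_mul_left hprod (by positivity)

open Real MeasureTheory Set in
/-- The power `x ^ q` is a mixture of the functions `x ↦ log⁺ (exp v * x)`. -/
theorem integrable_and_integral_exp_mul_posLog {q : ℝ} (hq : 0 < q) {x : ℝ} (hx : 0 ≤ x) :
    Integrable (fun v : ℝ => exp (-(q * v)) * posLog (exp v * x)) ∧
      ∫ v : ℝ, exp (-(q * v)) * posLog (exp v * x) = x ^ q / q ^ 2 := by
  rcases hx.eq_or_lt with rfl | hx
  · simp [hq.ne']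
  set a := -log x with ha
  have hpos : ∀ v, posLog (exp v * x) = max 0 (v - a) := fun v => by
    rw [posLog_apply, log_mul (exp_pos v).ne' hx.ne', log_exp, ha, sub_neg_eq_add]
  have hind : (fun v : ℝ => exp (-(q * v)) * posLog (exp v * x)) =
      (Ioi a).indicator (fun v => exp (-(q * v)) * (v - a)) := by
    funext v
    rw [hpos]
    by_cases hv : a < v
    · rw [indicator_of_mem (mem_Ioi.2 hv), max_eq_right (by linarith)]
    · rw [indicator_of_notMem (notMem_Ioi.2 (not_lt.1 hv)),
        max_eq_left (by linarith [not_lt.1 hv]), mul_zero]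
  let g : ℝ → ℝ := fun v => -(exp (-(q * v)) * ((v - a) / q + 1 / q ^ 2))
  have hderiv : ∀ v ∈ Ici a, HasDerivAt g (exp (-(q * v)) * (v - a)) v := fun v _ => by
    have h1 : HasDerivAt (fun v => exp (-(q * v))) (exp (-(q * v)) * -(q * 1)) v :=
      ((hasDerivAt_id v).const_mul q).neg.exp
    have h2 : HasDerivAt (fun v => (v - a) / q + 1 / q ^ 2) (1 / q) v :=
      (((hasDerivAt_id v).sub_const a).div_const q).add_const _
    refine (h1.mul h2).neg.congr_deriv ?_
    field_simp
    ring
  have hnn : ∀ v ∈ Ioi a, 0 ≤ exp (-(q * v)) * (v - a) := fun v hv =>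
    mul_nonneg (exp_pos _).le (sub_nonneg.2 (le_of_lt hv))
  have hlim : Tendsto g atTop (nhds 0) := by
    have h0 : Tendsto (fun v : ℝ => q * v) atTop atTop := tendsto_id.const_mul_atTop hq
    have h1 : Tendsto (fun v : ℝ => exp (-(q * v))) atTop (nhds 0) :=
      tendsto_exp_neg_atTop_nhds_zero.comp h0
    have h2 : Tendsto (fun v : ℝ => (q * v) ^ 1 * exp (-(q * v))) atTop (nhds 0) :=
      (tendsto_pow_mul_exp_neg_atTop_nhds_zero 1).comp h0
    have h3 := ((h2.const_mul (1 / q ^ 2)).add (h1.const_mul (1 / q ^ 2 - a / q))).neg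
    simp only [mul_zero, add_zero, neg_zero] at h3
    refine h3.congr fun v => ?_
    simp only [g]
    field_simp
    ring
  rw [hind, integrable_indicator_iff measurableSet_Ioi, integral_indicator measurableSet_Ioi]
  refine ⟨integrableOn_Ioi_deriv_of_nonneg' hderiv hnn hlim, ?_⟩
  rw [integral_Ioi_of_hasDerivAt_of_nonneg' hderiv hnn hlim, rpow_def_of_pos hx]
  simp only [g, ha]
  ring_nf

open Real MeasureTheory in
/-- Weak log-majorization implies the inequality between sums of `q`-th powers. -/
theorem sum_rpow_le_sum_rpow_of_prod_max_le {ι : Type*} [Fintype ι] {a b : ι → ℝ}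
    (ha : ∀ i, 0 ≤ a i) (hb : ∀ i, 0 ≤ b i)
    (h : ∀ t : ℝ, 0 < t → ∏ i, max 1 (t * a i) ≤ ∏ i, max 1 (t * b i)) {q : ℝ} (hq : 0 < q) :
    ∑ i, a i ^ q ≤ ∑ i, b i ^ q := by
  have hlog : ∀ c : ι → ℝ, (∀ i, 0 ≤ c i) → ∀ v : ℝ,
      ∑ i, posLog (exp v * c i) = log (∏ i, max 1 (exp v * c i)) := fun c hc v => by
    rw [log_prod fun i _ => (lt_max_of_lt_left one_pos).ne']
    exact Finset.sum_congr rfl fun i _ =>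
      posLog_eq_log_max_one (mul_nonneg (exp_pos v).le (hc i))
  have hint : ∀ c : ι → ℝ, (∀ i, 0 ≤ c i) →
      Integrable (fun v : ℝ => ∑ i, exp (-(q * v)) * posLog (exp v * c i)) ∧
      ∫ v : ℝ, ∑ i, exp (-(q * v)) * posLog (exp v * c i) = (∑ i, c i ^ q) / q ^ 2 :=
    fun c hc => by
      have := fun i => integrable_and_integral_exp_mul_posLog hq (hc i)
      refine ⟨integrable_finsetSum _ fun i _ => (this i).1, ?_⟩
      rw [integral_finsetSum _ fun i _ => (this i).1, Finset.sum_div]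
      exact Finset.sum_congr rfl fun i _ => (this i).2
  have hle := integral_mono (hint a ha).1 (hint b hb).1 fun v => by
    simp only [← Finset.mul_sum, hlog a ha, hlog b hb]
    refine mul_le_mul_of_nonneg_left (log_le_log ?_ (h _ (exp_pos v))) (exp_pos _).le
    exact Finset.prod_pos fun i _ => lt_max_of_lt_left one_pos
  rw [(hint a ha).2, (hint b hb).2] at hle
  exact (div_le_div_iff_of_pos_right (by positivity)).1 hle

/-- Weak log-majorization of the diagonal of a Schur form of `A` by the singular values of `A`. -/
theorem prod_max_norm_sq_diag_le_prod_max_eigenvalues {n : ℕ} {U A : Matrix (Fin n) (Fin n) ℂ}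
    (hU : U ∈ Matrix.unitaryGroup (Fin n) ℂ) (hT : (Uᴴ * A * U).IsUpperTriangular)
    (hH : (Aᴴ * A).IsHermitian) {t : ℝ} (ht : 0 ≤ t) :
    ∏ i, max 1 (t * ‖(Uᴴ * A * U) i i‖ ^ 2) ≤ ∏ i, max 1 (t * hH.eigenvalues i) := by
  have hU1 : Uᴴ * U = 1 := Matrix.mem_unitaryGroup_iff'.1 hU
  have hU2 : U * Uᴴ = 1 := Matrix.mem_unitaryGroup_iff.1 hU
  set W : Matrix (Fin n) (Fin n) ℂ := hH.eigenvectorUnitary.1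
  have hW2 : W * Wᴴ = 1 := Matrix.mem_unitaryGroup_iff.1 hH.eigenvectorUnitary.2
  let e : Fin n → ℂ := fun i => (hH.eigenvalues i : ℂ)
  have hspec : Aᴴ * A = W * diagonal e * Wᴴ := by
    conv_lhs => rw [hH.spectral_theorem]
    rfl
  let k : Fin n → ℂ := fun i => ((max 1 (t * hH.eigenvalues i) : ℝ) : ℂ)
  let S := Uᴴ * W
  have hS1 : S * Sᴴ = 1 := by
    simp only [S, conjTranspose_mul, conjTranspose_conjTranspose]
    rw [Matrix.mul_assoc, ← Matrix.mul_assoc W, hW2, Matrix.one_mul, hU1]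
  have hTT : (Uᴴ * A * U)ᴴ * (Uᴴ * A * U) = S * diagonal e * Sᴴ := by
    have : (Uᴴ * A * U)ᴴ * (Uᴴ * A * U) = Uᴴ * (Aᴴ * ((U * Uᴴ) * A)) * U := by
      simp only [conjTranspose_mul, conjTranspose_conjTranspose, Matrix.mul_assoc]
    rw [this, hU2, Matrix.one_mul, hspec]
    simp only [S, conjTranspose_mul, conjTranspose_conjTranspose, Matrix.mul_assoc]
  have hsemi : ((S * diagonal k * Sᴴ) - 1).PosSemidef := by
    have : (S * diagonal k * Sᴴ) - 1 = S * diagonal (fun i => k i - 1) * Sᴴ := by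
      rw [← diagonal_sub, Matrix.mul_sub, Matrix.sub_mul]
      simp [hS1]
    rw [this]
    refine (Matrix.posSemidef_diagonal_iff.2 fun i => ?_).mul_mul_conjTranspose_same S
    rw [sub_nonneg]
    change (1 : ℂ) ≤ ((max 1 (t * hH.eigenvalues i) : ℝ) : ℂ)
    exact_mod_cast le_max_left _ _
  have hpos : (S * diagonal k * Sᴴ).PosDef := by
    have := Matrix.PosDef.posSemidef_add hsemi (Matrix.PosDef.one (n := Fin n) (R := ℂ))
    rwa [sub_add_cancel] at this
  refine (prod_max_norm_sq_diag_le_re_det hT ht hpos hsemi ?_).trans_eq ?_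
  · have : (S * diagonal k * Sᴴ) - (t : ℂ) • ((Uᴴ * A * U)ᴴ * (Uᴴ * A * U)) =
        S * diagonal (fun i => k i - t * e i) * Sᴴ := by
      rw [hTT, ← diagonal_sub, Matrix.mul_sub, Matrix.sub_mul]
      have : diagonal (fun i => (t : ℂ) * e i) = (t : ℂ) • diagonal e := by
        rw [← diagonal_smul]; rfl
      rw [this]
      simp
    rw [this]
    refine (Matrix.posSemidef_diagonal_iff.2 fun i => ?_).mul_mul_conjTranspose_same S
    rw [sub_nonneg]
    change (t : ℂ) * (hH.eigenvalues i : ℂ) ≤ ((max 1 (t * hH.eigenvalues i) : ℝ) : ℂ)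
    exact_mod_cast le_max_right _ _
  · rw [det_mul, det_mul, mul_right_comm, ← det_mul, hS1, det_one, one_mul, det_diagonal,
      ← Complex.ofReal_prod, Complex.ofReal_re]

/-- The trace of `|A|^p` in terms of the eigenvalues of `AᴴA`. -/
theorem trace_absPow_re {m : ℕ} (A : Matrix (Fin m) (Fin m) ℂ) (p : ℝ)
    (hH : (Aᴴ * A).IsHermitian) :
    (Matrix.trace (absPow A p)).re = ∑ i, hH.eigenvalues i ^ (p / 2) := by
  rw [absPow, hH.cfc_eq, IsHermitian.cfc, Unitary.conjStarAlgAut_apply, trace_mul_comm,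
    ← Matrix.mul_assoc]
  simp [trace_diagonal]

end

/-- Let A ∈ M_m(ℂ) with eigenvalues λ_1, ..., λ_m counted with multiplicity. Then for every
0 ≤ p < ∞, ∑_{i=1}^m |λ_i|^p ≤ tr(|A|^p). -/
theorem sum_rpow_abs_eigenvalues_le_trace (m : ℕ) (A : Matrix (Fin m) (Fin m) ℂ)
    (μ : Fin m → ℂ) (hμ : A.charpoly = ∏ i, (X - C (μ i))) (p : ℝ) (hp : 0 ≤ p) :
    ∑ i, ‖μ i‖ ^ p ≤ (Matrix.trace (absPow A p)).re := by
  have hH : (Aᴴ * A).IsHermitian := isHermitian_conjTranspose_mul_self A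
  rw [trace_absPow_re A p hH]
  rcases hp.eq_or_lt with rfl | hp
  · simp
  obtain ⟨U, hU, hT⟩ := exists_unitary_isUpperTriangular m A
  have hchar : (Uᴴ * A * U).charpoly = A.charpoly := by
    rw [charpoly_mul_comm, ← Matrix.mul_assoc, show U * Uᴴ = 1 from
      Matrix.mem_unitaryGroup_iff.1 hU, Matrix.one_mul]
  have hroots : Multiset.map μ Finset.univ.val =
      Multiset.map (fun i => (Uᴴ * A * U) i i) Finset.univ.val := by
    have hprod : ∀ f : Fin m → ℂ, (∏ i, (X - C (f i))).roots = Multiset.map f Finset.univ.val :=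
      fun f => by
        have := Polynomial.roots_multiset_prod_X_sub_C (Multiset.map f Finset.univ.val)
        rwa [Multiset.map_map] at this
    rw [← hprod μ, ← hprod, ← hμ, ← hchar, charpoly_of_isUpperTriangular _ hT]
  have hsum : ∑ i, ‖μ i‖ ^ p = ∑ i, (‖(Uᴴ * A * U) i i‖ ^ 2) ^ (p / 2) := by
    have := congrArg (fun s => (Multiset.map (fun z : ℂ => ‖z‖ ^ p) s).sum) hroots
    simp only [Multiset.map_map, Function.comp_def] at this
    refine Eq.trans this (Finset.sum_congr rfl fun i _ => ?_)
    rw [← Real.rpow_natCast, ← Real.rpow_mul (norm_nonneg _)]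
    congr 1
    push_cast
    ring
  rw [hsum]
  exact sum_rpow_le_sum_rpow_of_prod_max_le (fun i => by positivity)
    (open scoped ComplexOrder in
      fun i => (posSemidef_conjTranspose_mul_self A).eigenvalues_nonneg i)
    (fun t ht => prod_max_norm_sq_diag_le_prod_max_eigenvalues hU hT hH ht.le) (half_pos hp)
end

section
/- (Generalized Hölder's inequality for traces) Let A_1, A_2, ..., A_k ∈ M_m(ℂ), and let r, p_1, ..., p_k ∈ (0, ∞) satisfy ∑_{i=1}^k 1/p_i = 1/r. Then (tr(|A_1 A_2 ⋯ A_k|^r))^{1/r} ≤ ∏_{i=1}^k (tr(|A_i|^{p_i}))^{1/p_i}. -/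
open Filter Matrix Polynomial

/-- The Cauchy–Binet formula, as a sum over all maps `n → ι` instead of all `n`-element subsets. -/
theorem Matrix.factorial_card_mul_det_mul {n ι R : Type*} [Fintype n] [DecidableEq n] [Fintype ι]
    [CommRing R] (M : Matrix n ι R) (N : Matrix ι n R) :
    ((Fintype.card n).factorial : R) * (M * N).det =
      ∑ f : n → ι, (M.submatrix id f).det * (N.submatrix f id).det := by
  classical
  have expand : (M * N).det = ∑ f : n → ι, (M.submatrix id f).det * ∏ i, N (f i) i := by
    simp only [det_apply', mul_apply, Finset.prod_univ_sum, Finset.mul_sum, Finset.sum_mul,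
      Fintype.piFinset_univ, Finset.prod_mul_distrib, submatrix_apply, id_eq, mul_assoc]
    exact Finset.sum_comm
  have reindex (σ : Equiv.Perm n) :
      (M * N).det = ∑ f : n → ι,
        (M.submatrix id f).det * (((Equiv.Perm.sign σ : ℤ) : R) * ∏ i, N (f (σ i)) i) := by
    rw [expand, ← (Equiv.arrowCongr σ.symm (Equiv.refl ι)).sum_comp]
    refine Finset.sum_congr rfl fun f _ => ?_
    change (M.submatrix id (f ∘ σ)).det * ∏ i, N (f (σ i)) i = _
    have : (M.submatrix id (f ∘ σ)).det = _ := det_permute' σ (M.submatrix id f)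
    rw [this]
    ring
  calc ((Fintype.card n).factorial : R) * (M * N).det
      = ∑ σ : Equiv.Perm n, (M * N).det := by
        simp [Fintype.card_perm]
    _ = _ := by
        rw [Finset.sum_congr rfl fun σ _ => reindex σ, Finset.sum_comm]
        refine Finset.sum_congr rfl fun f _ => ?_
        rw [det_apply' (N.submatrix f id), Finset.mul_sum]
        simp

/-- Among products of `n` distinct terms of a decreasing sequence, the product of the first `n` is
the largest. -/
theorem Antitone.prod_comp_le_prod_fin {R : Type*} [CommSemiring R] [PartialOrder R]
    [IsOrderedRing R] {l : ℕ → R} (hl : Antitone l) (h0 : ∀ i, 0 ≤ l i) {n : ℕ}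
    {f : Fin n → ℕ} (hf : Function.Injective f) :
    ∏ i, l (f i) ≤ ∏ i : Fin n, l i := by
  have hcard : (Finset.univ.image f).card = n := by
    rw [Finset.card_image_of_injective _ hf, Finset.card_fin]
  have hle (i : Fin n) : (i : ℕ) ≤ (Finset.univ.image f).orderEmbOfFin hcard i := by
    obtain ⟨i, hi⟩ := i
    induction i with
    | zero => simp
    | succ i ih =>
      refine Nat.succ_le_of_lt ((ih (by lia)).trans_lt ?_)
      exact (Finset.orderEmbOfFin _ _).strictMono (by simp)
  calc ∏ i, l (f i) = ∏ j ∈ Finset.univ.image f, l j := by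
        rw [Finset.prod_image fun _ _ _ _ h => hf h]
    _ = ∏ i, l ((Finset.univ.image f).orderEmbOfFin hcard i) := by
        rw [← Finset.prod_image (s := Finset.univ)
          (g := (Finset.univ.image f).orderEmbOfFin hcard) (f := l)
          fun _ _ _ _ h => (Finset.orderEmbOfFin _ hcard).injective h,
          Finset.image_orderEmbOfFin_univ]
    _ ≤ ∏ i : Fin n, l i := Finset.prod_le_prod (fun _ _ => h0 _) fun i _ => hl (hle i)

/-- For `X` with `n` columns and a unitarily diagonalised positive semidefinite `H`,
compression by `X` scales the Gram determinant by at most the product of the `n` largest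
eigenvalues of `H`. -/
theorem Matrix.re_det_conjTranspose_mul_mul_le {m n : ℕ} {H U : Matrix (Fin m) (Fin m) ℂ}
    {l : ℕ → ℝ} (hl : Antitone l) (h0 : ∀ i, 0 ≤ l i) (hU : U * Uᴴ = 1)
    (hH : H = U * diagonal (fun i : Fin m => (l i : ℂ)) * Uᴴ) (X : Matrix (Fin m) (Fin n) ℂ) :
    (Xᴴ * H * X).det.re ≤ (∏ i : Fin n, l i) * (Xᴴ * X).det.re := by
  set Y := Uᴴ * X with hY
  have key (d : Fin m → ℝ) :
      (n.factorial : ℝ) * (Yᴴ * (diagonal (fun i => (d i : ℂ)) * Y)).det.re =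
        ∑ f : Fin n → Fin m, (∏ i, d (f i)) * Complex.normSq (Y.submatrix f id).det := by
    have h := factorial_card_mul_det_mul Yᴴ (diagonal (fun i => (d i : ℂ)) * Y)
    have h' (f : Fin n → Fin m) :
        (Yᴴ.submatrix id f).det * ((diagonal (fun i => (d i : ℂ)) * Y).submatrix f id).det =
          (((∏ i, d (f i)) * Complex.normSq (Y.submatrix f id).det : ℝ) : ℂ) := by
      have h1 : (diagonal (fun i => (d i : ℂ)) * Y).submatrix f id =
          diagonal (fun i => (d (f i) : ℂ)) * Y.submatrix f id := by
        ext i j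
        simp
      have h2 : Yᴴ.submatrix id f = (Y.submatrix f id)ᴴ := rfl
      rw [h1, h2, det_mul, det_diagonal, det_conjTranspose]
      push_cast
      rw [Complex.normSq_eq_conj_mul_self]
      simp only [RCLike.star_def]
      ring
    simp only [h', Fintype.card_fin] at h
    rw [← Complex.ofReal_sum] at h
    have := congrArg Complex.re h
    rwa [← Complex.ofReal_natCast, Complex.re_ofReal_mul, Complex.ofReal_re] at this
  have e1 : Xᴴ * H * X = Yᴴ * (diagonal (fun i : Fin m => (l i : ℂ)) * Y) := by
    simp [hY, hH, Matrix.mul_assoc]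
  have e2 : Xᴴ * X = Yᴴ * (diagonal (fun _ : Fin m => ((1 : ℝ) : ℂ)) * Y) := by
    simp only [Complex.ofReal_one, diagonal_one, Matrix.one_mul, hY, conjTranspose_mul,
      conjTranspose_conjTranspose]
    rw [Matrix.mul_assoc, ← Matrix.mul_assoc U, hU, Matrix.one_mul]
  rw [← mul_le_mul_iff_right₀ (show (0 : ℝ) < n.factorial by positivity), mul_left_comm, e1, e2,
    key, key, Finset.mul_sum]
  refine Finset.sum_le_sum fun f _ => ?_
  by_cases hf : Function.Injective f
  · rw [Finset.prod_const_one, one_mul]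
    exact mul_le_mul_of_nonneg_right (hl.prod_comp_le_prod_fin h0
      (Fin.val_injective.comp hf)) (Complex.normSq_nonneg _)
  · obtain ⟨i, j, hij, hne⟩ : ∃ i j, f i = f j ∧ i ≠ j := by
      simpa [Function.Injective] using hf
    have : (Y.submatrix f id).det = 0 := det_zero_of_row_eq hne (by ext; simp [hij])
    simp [this]

open ComplexOrder in
/-- The spectral theorem with eigenvalues in decreasing order, indexed by `ℕ`. -/
theorem Matrix.PosSemidef.exists_antitone_eigenvalues {m : ℕ} {H : Matrix (Fin m) (Fin m) ℂ}
    (hH : H.PosSemidef) :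
    ∃ (l : ℕ → ℝ) (U : Matrix (Fin m) (Fin m) ℂ), Antitone l ∧ (∀ i, 0 ≤ l i) ∧
      U * Uᴴ = 1 ∧ H = U * diagonal (fun i : Fin m => (l i : ℂ)) * Uᴴ ∧
      ∀ f : ℝ → ℝ, (cfc f H).trace.re = ∑ i ∈ Finset.range m, f (l i) := by
  have hh := hH.isHermitian
  have hcard : Fintype.card (Fin m) = m := Fintype.card_fin m
  let l : ℕ → ℝ := fun i => if h : i < Fintype.card (Fin m) then hh.eigenvalues₀ ⟨i, h⟩ else 0
  let e : Fin m ≃ Fin m := (finCongr hcard.symm).trans (Fintype.equivOfCardEq (Fintype.card_fin _))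
  have hle (i : Fin m) : l i = hh.eigenvalues (e i) := by
    have : (i : ℕ) < Fintype.card (Fin m) := by simp
    simp only [l, dif_pos this, IsHermitian.eigenvalues, e, Equiv.trans_apply,
      Equiv.symm_apply_apply]
    rfl
  have h0 (i) : 0 ≤ l i := by
    by_cases h : i < m
    · rw [hle ⟨i, h⟩]
      exact hH.eigenvalues_nonneg _
    · simp [l, h]
  let U : Matrix (Fin m) (Fin m) ℂ := (hh.eigenvectorUnitary : Matrix _ _ ℂ).submatrix id e
  have hUU : (hh.eigenvectorUnitary : Matrix (Fin m) (Fin m) ℂ) *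
      (hh.eigenvectorUnitary : Matrix (Fin m) (Fin m) ℂ)ᴴ = 1 :=
    Unitary.mul_star_self_of_mem hh.eigenvectorUnitary.2
  refine ⟨l, U, ?_, h0, ?_, ?_, fun f => ?_⟩
  · intro i j hij
    by_cases hj : j < Fintype.card (Fin m)
    · simp only [l, dif_pos hj, dif_pos (hij.trans_lt hj)]
      exact hh.eigenvalues₀_antitone hij
    · simpa only [l, dif_neg hj] using h0 i
  · simp only [U, conjTranspose_submatrix, submatrix_mul_equiv]
    rw [hUU]
    simp
  · have : diagonal (fun i : Fin m => (l i : ℂ)) =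
        (diagonal (RCLike.ofReal ∘ hh.eigenvalues)).submatrix e e := by
      rw [submatrix_diagonal_equiv]
      congr 1
      ext i
      simp [hle]
    rw [this]
    simp only [U, conjTranspose_submatrix, submatrix_mul_equiv]
    conv_lhs => rw [hh.spectral_theorem, Unitary.conjStarAlgAut_apply]
    rfl
  · rw [hh.cfc_eq, IsHermitian.cfc, Unitary.conjStarAlgAut_apply, trace_mul_cycle]
    simp [trace_diagonal, Finset.sum_range, hle, e.sum_comp fun i => f (hh.eigenvalues i)]

/-- Horn's inequality, for a product `A * B`, on the squares of the singular values. -/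
theorem Matrix.prod_eigenvalues_mul_le {m : ℕ} {A B U V W : Matrix (Fin m) (Fin m) ℂ}
    {a b c : ℕ → ℝ} (ha : Antitone a) (ha0 : ∀ i, 0 ≤ a i) (hU : U * Uᴴ = 1)
    (hA : Aᴴ * A = U * diagonal (fun i : Fin m => (a i : ℂ)) * Uᴴ)
    (hb : Antitone b) (hb0 : ∀ i, 0 ≤ b i) (hV : V * Vᴴ = 1)
    (hB : Bᴴ * B = V * diagonal (fun i : Fin m => (b i : ℂ)) * Vᴴ)
    (hW : W * Wᴴ = 1)
    (hC : (A * B)ᴴ * (A * B) = W * diagonal (fun i : Fin m => (c i : ℂ)) * Wᴴ)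
    {n : ℕ} (hn : n ≤ m) :
    ∏ i ∈ Finset.range n, c i ≤ ∏ i ∈ Finset.range n, a i * b i := by
  have hW' : Wᴴ * W = 1 := mul_eq_one_comm.mp hW
  let X : Matrix (Fin m) (Fin n) ℂ := W.submatrix id (Fin.castLE hn)
  have hX (M : Matrix (Fin m) (Fin m) ℂ) :
      Xᴴ * M * X = (Wᴴ * M * W).submatrix (Fin.castLE hn) (Fin.castLE hn) := by
    ext; simp [X, Matrix.mul_apply]
  have hXX : Xᴴ * X = 1 := by
    have := hX 1
    rwa [Matrix.mul_one, Matrix.mul_one, hW', submatrix_one _ (Fin.castLE_injective hn)] at this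
  have hdet : (Xᴴ * ((A * B)ᴴ * (A * B)) * X).det.re = ∏ i ∈ Finset.range n, c i := by
    have : Wᴴ * ((A * B)ᴴ * (A * B)) * W = diagonal (fun i : Fin m => (c i : ℂ)) := by
      rw [hC]
      simp only [Matrix.mul_assoc, hW', Matrix.mul_one]
      rw [← Matrix.mul_assoc, hW', Matrix.one_mul]
    rw [hX, this, submatrix_diagonal _ _ (Fin.castLE_injective hn), det_diagonal,
      Finset.prod_range]
    simp only [Function.comp_apply, Fin.val_castLE]
    rw [← Complex.ofReal_prod, Complex.ofReal_re]
  calc ∏ i ∈ Finset.range n, c i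
      = ((B * X)ᴴ * (Aᴴ * A) * (B * X)).det.re := by
        rw [← hdet]
        simp only [conjTranspose_mul, Matrix.mul_assoc]
    _ ≤ (∏ i : Fin n, a i) * ((B * X)ᴴ * (B * X)).det.re :=
        re_det_conjTranspose_mul_mul_le ha ha0 hU hA _
    _ = (∏ i : Fin n, a i) * (Xᴴ * (Bᴴ * B) * X).det.re := by
        simp only [conjTranspose_mul, Matrix.mul_assoc]
    _ ≤ (∏ i : Fin n, a i) * ((∏ i : Fin n, b i) * (Xᴴ * X).det.re) :=
        mul_le_mul_of_nonneg_left (re_det_conjTranspose_mul_mul_le hb hb0 hV hB _)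
          (Finset.prod_nonneg fun _ _ => ha0 _)
    _ = ∏ i ∈ Finset.range n, a i * b i := by
        simp [hXX, Finset.prod_range, Finset.prod_mul_distrib]

/-- A weighted sum with nonnegative decreasing weights is nonnegative if all partial sums of the
unweighted terms are. -/
theorem Antitone.sum_mul_nonneg {w d : ℕ → ℝ} (hw : Antitone w) (hw0 : ∀ i, 0 ≤ w i) {m : ℕ}
    (hd : ∀ n ≤ m, 0 ≤ ∑ i ∈ Finset.range n, d i) :
    0 ≤ ∑ i ∈ Finset.range m, w i * d i := by
  have key : ∀ n ≤ m, w n * ∑ i ∈ Finset.range n, d i ≤ ∑ i ∈ Finset.range n, w i * d i := by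
    intro n
    induction n with
    | zero => simp
    | succ n ih =>
      intro hn
      have h1 := ih (by lia)
      have h2 := mul_le_mul_of_nonneg_right (hw n.le_succ) (hd _ hn)
      rw [Finset.sum_range_succ (fun i => w i * d i)]
      refine h2.trans ?_
      rw [Finset.sum_range_succ, mul_add]
      linarith
  exact (mul_nonneg (hw0 m) (hd m le_rfl)).trans (key m le_rfl)

/-- Weak log-majorization implies the inequality of power sums. -/
theorem Antitone.sum_rpow_le_sum_rpow {x y : ℕ → ℝ} (hx : Antitone x) (hx0 : ∀ i, 0 ≤ x i)
    (hy0 : ∀ i, 0 ≤ y i) {s : ℝ} (hs : 0 < s) {m : ℕ}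
    (h : ∀ n ≤ m, ∏ i ∈ Finset.range n, x i ≤ ∏ i ∈ Finset.range n, y i) :
    ∑ i ∈ Finset.range m, x i ^ s ≤ ∑ i ∈ Finset.range m, y i ^ s := by
  induction m with
  | zero => simp
  | succ m ih =>
    rcases (hx0 m).eq_or_lt with hm | hm
    · rw [Finset.sum_range_succ, Finset.sum_range_succ, ← hm, Real.zero_rpow hs.ne']
      exact add_le_add (ih fun n hn => h n (by lia)) (Real.rpow_nonneg (hy0 m) s)
    have hxpos (i) (hi : i < m + 1) : 0 < x i := hm.trans_le (hx (by lia))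
    have hypos (i) (hi : i < m + 1) : 0 < y i := by
      refine (hy0 i).lt_of_ne' fun hi0 => ?_
      have h1 := h (m + 1) le_rfl
      rw [Finset.prod_eq_zero (Finset.mem_range.mpr hi) hi0] at h1
      exact h1.not_gt (Finset.prod_pos fun j hj => hxpos j (Finset.mem_range.mp hj))
    have hd : ∀ n ≤ m + 1, 0 ≤ ∑ i ∈ Finset.range n, s * (Real.log (y i) - Real.log (x i)) := by
      intro n hn
      rw [← Finset.mul_sum, Finset.sum_sub_distrib,
        ← Real.log_prod fun i hi => (hxpos i (by have := Finset.mem_range.mp hi; lia)).ne',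
        ← Real.log_prod fun i hi => (hypos i (by have := Finset.mem_range.mp hi; lia)).ne']
      exact mul_nonneg hs.le (sub_nonneg.mpr (Real.log_le_log (Finset.prod_pos fun i hi =>
        hxpos i (by have := Finset.mem_range.mp hi; lia)) (h n hn)))
    have hsum := Antitone.sum_mul_nonneg (w := fun i => x i ^ s)
      (fun i j hij => Real.rpow_le_rpow (hx0 j) (hx hij) hs.le)
      (fun i => Real.rpow_nonneg (hx0 i) s) hd
    rw [← sub_nonneg, ← Finset.sum_sub_distrib]
    refine hsum.trans (Finset.sum_le_sum fun i hi => ?_)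
    have hxi := hxpos i (Finset.mem_range.mp hi)
    have hyi := hypos i (Finset.mem_range.mp hi)
    have e : y i ^ s = x i ^ s * Real.exp (s * (Real.log (y i) - Real.log (x i))) := by
      rw [Real.rpow_def_of_pos hxi, Real.rpow_def_of_pos hyi, ← Real.exp_add]
      ring_nf
    rw [e]
    nlinarith [Real.add_one_le_exp (s * (Real.log (y i) - Real.log (x i))),
      Real.rpow_pos_of_pos hxi s]

open ComplexOrder in
theorem re_trace_absPow_nonneg {m : ℕ} (T : Matrix (Fin m) (Fin m) ℂ) (p : ℝ) :
    0 ≤ (absPow T p).trace.re := by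
  obtain ⟨l, -, -, h0, -, -, h⟩ :=
    (posSemidef_conjTranspose_mul_self T).exists_antitone_eigenvalues
  rw [absPow, h]
  exact Finset.sum_nonneg fun i _ => Real.rpow_nonneg (h0 i) _

open ComplexOrder in
/-- Hölder's inequality for the Schatten quasi-norms of a product of two matrices. -/
theorem re_trace_absPow_mul_le {m : ℕ} (A B : Matrix (Fin m) (Fin m) ℂ) {p q r : ℝ}
    (hpqr : p.HolderTriple q r) :
    (absPow (A * B) r).trace.re ^ (1 / r) ≤
      (absPow A p).trace.re ^ (1 / p) * (absPow B q).trace.re ^ (1 / q) := by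
  obtain ⟨a, U, ha, ha0, hU, hA, hta⟩ :=
    (posSemidef_conjTranspose_mul_self A).exists_antitone_eigenvalues
  obtain ⟨b, V, hb, hb0, hV, hB, htb⟩ :=
    (posSemidef_conjTranspose_mul_self B).exists_antitone_eigenvalues
  obtain ⟨c, W, hc, hc0, hW, hC, htc⟩ :=
    (posSemidef_conjTranspose_mul_self (A * B)).exists_antitone_eigenvalues
  have hmaj := hc.sum_rpow_le_sum_rpow hc0 (fun i => mul_nonneg (ha0 i) (hb0 i))
    (half_pos hpqr.pos') fun n hn => prod_eigenvalues_mul_le ha ha0 hU hA hb hb0 hV hB hW hC hn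
  have hsqrt {t : ℝ} (ht : 0 ≤ t) (s : ℝ) : |√t| ^ s = t ^ (s / 2) := by
    rw [abs_of_nonneg (Real.sqrt_nonneg t), Real.sqrt_eq_rpow, ← Real.rpow_mul ht]
    ring_nf
  have hholder := Real.Lr_rpow_le_Lp_mul_Lq (Finset.range m) (fun i => √(a i)) (fun i => √(b i))
    hpqr
  simp only [← Real.sqrt_mul (ha0 _), hsqrt (ha0 _), hsqrt (hb0 _),
    hsqrt (mul_nonneg (ha0 _) (hb0 _))] at hholder
  have hSa := Finset.sum_nonneg fun i (_ : i ∈ Finset.range m) => Real.rpow_nonneg (ha0 i) (p / 2)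
  have hSb := Finset.sum_nonneg fun i (_ : i ∈ Finset.range m) => Real.rpow_nonneg (hb0 i) (q / 2)
  have hSc := Finset.sum_nonneg fun i (_ : i ∈ Finset.range m) => Real.rpow_nonneg (hc0 i) (r / 2)
  simp only [absPow, hta, htb, htc]
  refine (Real.rpow_le_rpow hSc (hmaj.trans hholder) (one_div_pos.mpr hpqr.pos').le).trans_eq ?_
  have hr := hpqr.pos'.ne'
  rw [Real.mul_rpow (Real.rpow_nonneg hSa _) (Real.rpow_nonneg hSb _), ← Real.rpow_mul hSa,
    ← Real.rpow_mul hSb]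
  congr 2 <;> field_simp

/-- (Generalized Hölder's inequality for traces) Let A_1, ..., A_k ∈ M_m(ℂ), and let
r, p_1, ..., p_k ∈ (0, ∞) satisfy ∑ 1/p_i = 1/r. Then
(tr(|A_1 ⋯ A_k|^r))^{1/r} ≤ ∏_i (tr(|A_i|^{p_i}))^{1/p_i}. -/
theorem trace_rpow_prod_le_prod_trace_rpow (m k : ℕ)
    (A : Fin k → Matrix (Fin m) (Fin m) ℂ) (r : ℝ) (p : Fin k → ℝ)
    (hr : 0 < r) (hp : ∀ i, 0 < p i) (hsum : ∑ i, 1 / p i = 1 / r) :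
    (Matrix.trace (absPow (List.ofFn A).prod r)).re ^ (1 / r) ≤
      ∏ i, (Matrix.trace (absPow (A i) (p i))).re ^ (1 / p i) := by
  induction k generalizing r with
  | zero => exact absurd hsum.symm (by simpa using hr.ne')
  | succ k ih =>
    rw [List.ofFn_succ, List.prod_cons, Fin.prod_univ_succ]
    rw [Fin.sum_univ_succ] at hsum
    rcases k.eq_zero_or_pos with rfl | hk
    · have : p 0 = r := by simpa using hsum
      simp [this]
    · have : Nonempty (Fin k) := ⟨⟨0, hk⟩⟩
      have hpos : 0 < ∑ i : Fin k, 1 / p i.succ :=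
        Finset.sum_pos (fun i _ => one_div_pos.mpr (hp _)) Finset.univ_nonempty
      have hq := ih (fun i => A i.succ) (1 / ∑ i : Fin k, 1 / p i.succ) (fun i => p i.succ)
        (one_div_pos.mpr hpos) (fun i => hp _) (one_div_one_div _).symm
      refine (re_trace_absPow_mul_le _ _ (p := p 0) (q := 1 / ∑ i : Fin k, 1 / p i.succ)
        ⟨?_, hp 0, one_div_pos.mpr hpos⟩).trans
        (mul_le_mul_of_nonneg_left hq (Real.rpow_nonneg (re_trace_absPow_nonneg _ _) _))
      simpa using hsum
end

section
/- Let A ∈ M_m(ℂ). For every n ∈ ℕ with n ≥ 1 and every p ∈ (0, ∞), tr(|A^n|^{p/n}) ≤ tr(|A|^p). -/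
open Filter Matrix Polynomial

/-- The **Cauchy–Binet formula**, summed over all functions rather than over subsets. -/
theorem factorial_mul_det_mul {κ ι R : Type*} [Fintype κ] [DecidableEq κ] [Fintype ι]
    [CommRing R] (M : Matrix κ ι R) (N : Matrix ι κ R) :
    ((Fintype.card κ).factorial : R) * (M * N).det =
      ∑ f : κ → ι, (M.submatrix id f).det * (N.submatrix f id).det := by
  classical
  have expand : (M * N).det = ∑ f : κ → ι, (M.submatrix id f).det * ∏ i, N (f i) i := by
    simp only [det_apply', mul_apply, Finset.prod_univ_sum, Finset.mul_sum, Finset.sum_mul,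
      Fintype.piFinset_univ]
    rw [Finset.sum_comm]
    simp [Finset.prod_mul_distrib, mul_assoc]
  have twist (σ : Equiv.Perm κ) : (M * N).det =
      ∑ f : κ → ι, (M.submatrix id f).det * ((Equiv.Perm.sign σ : ℤ) * ∏ i, N (f (σ i)) i) := by
    rw [expand, ← Equiv.sum_comp (Equiv.arrowCongr σ.symm (Equiv.refl ι))]
    refine Finset.sum_congr rfl fun f _ => ?_
    have h : (M.submatrix id (f ∘ σ)).det = (Equiv.Perm.sign σ : ℤ) * (M.submatrix id f).det :=
      det_permute' σ (M.submatrix id f)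
    change (M.submatrix id (f ∘ σ)).det * ∏ i, N (f (σ i)) i = _
    rw [h]
    ring
  have hsum : ∑ _σ : Equiv.Perm κ, (M * N).det =
      ((Fintype.card κ).factorial : R) * (M * N).det := by
    simp [Fintype.card_perm]
  rw [← hsum, Finset.sum_congr rfl fun σ _ => twist σ, Finset.sum_comm]
  refine Finset.sum_congr rfl fun f _ => ?_
  rw [← Finset.mul_sum, det_apply' (N.submatrix f id)]
  rfl

/-- The `k` first values of a nonnegative antitone sequence have the largest product. -/
theorem prod_comp_le_prod_of_antitone {k : ℕ} {lam : ℕ → ℝ} (hlam : Antitone lam)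
    (h0 : ∀ i, 0 ≤ lam i) {f : Fin k → ℕ} (hf : Function.Injective f) :
    ∏ j, lam (f j) ≤ ∏ j : Fin k, lam j := by
  rw [← Equiv.prod_comp (Tuple.sort f)]
  have hs : StrictMono (f ∘ Tuple.sort f) :=
    (Tuple.monotone_sort f).strictMono_of_injective (hf.comp (Tuple.sort f).injective)
  have hle (n : ℕ) (hn : n < k) : n ≤ f (Tuple.sort f ⟨n, hn⟩) := by
    induction n with
    | zero => exact Nat.zero_le _
    | succ n ih =>
      have h := hs (show (⟨n, by omega⟩ : Fin k) < ⟨n + 1, hn⟩ from Nat.lt_succ_self n)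
      exact (ih (by omega)).trans_lt h
  exact Finset.prod_le_prod (fun _ _ => h0 _) fun j _ => hlam (hle j j.2)

theorem re_det_conjTranspose_mul_diagonal_mul_le {m k : ℕ} {lam : ℕ → ℝ} (hlam : Antitone lam)
    (h0 : ∀ i, 0 ≤ lam i) (W : Matrix (Fin m) (Fin k) ℂ) :
    (Wᴴ * (diagonal (fun i : Fin m => (lam i : ℂ)) * W)).det.re ≤
      (∏ j : Fin k, lam j) * (Wᴴ * W).det.re := by
  have hW (f : Fin k → Fin m) :
      (Wᴴ.submatrix id f).det = star (W.submatrix f id).det := by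
    rw [← det_conjTranspose, conjTranspose_submatrix]
  have hD (f : Fin k → Fin m) :
      ((diagonal (fun i : Fin m => (lam i : ℂ)) * W).submatrix f id).det =
        ((∏ j, lam (f j) : ℝ) : ℂ) * (W.submatrix f id).det := by
    rw [Complex.ofReal_prod, ← det_diagonal, ← det_mul]
    congr 1
    ext i j
    simp
  have hre (c : ℝ) (z : ℂ) : (star z * (c * z)).re = c * Complex.normSq z := by
    simp [Complex.normSq_apply]
    ring
  have e₁ := congrArg Complex.re
    (factorial_mul_det_mul Wᴴ (diagonal (fun i : Fin m => (lam i : ℂ)) * W))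
  have e₂ := congrArg Complex.re (factorial_mul_det_mul Wᴴ W)
  simp only [hW, hD, Complex.re_sum, hre, ← Complex.ofReal_natCast,
    Complex.re_ofReal_mul] at e₁ e₂
  have hpos : (0 : ℝ) < ((Fintype.card (Fin k)).factorial : ℕ) := by
    exact_mod_cast Nat.factorial_pos _
  refine le_of_mul_le_mul_left ?_ hpos
  rw [e₁, mul_left_comm, e₂, Finset.mul_sum]
  refine Finset.sum_le_sum fun f _ => ?_
  have hre' : (star (W.submatrix f id).det * (W.submatrix f id).det).re =
      Complex.normSq (W.submatrix f id).det := by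
    simpa using hre 1 (W.submatrix f id).det
  rw [hre']
  by_cases hf : Function.Injective f
  · exact mul_le_mul_of_nonneg_right
      (prod_comp_le_prod_of_antitone hlam h0 (Fin.val_injective.comp hf)) (Complex.normSq_nonneg _)
  · obtain ⟨i, j, hij, hne⟩ := Function.not_injective_iff.mp hf
    rw [det_zero_of_row_eq hne (by ext l; simp [hij])]
    simp

open scoped ComplexOrder in
/-- Spectral theorem for `TᴴT`, with the eigenvalues in decreasing order and extended by zero. -/
theorem exists_antitone_spectral_decomposition {m : ℕ} (T : Matrix (Fin m) (Fin m) ℂ) :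
    ∃ (lam : ℕ → ℝ) (U : Matrix (Fin m) (Fin m) ℂ), Antitone lam ∧ (∀ i, 0 ≤ lam i) ∧
      Uᴴ * U = 1 ∧ U * Uᴴ = 1 ∧
      Tᴴ * T = U * diagonal (fun i : Fin m => (lam i : ℂ)) * Uᴴ ∧
      ∀ p, (absPow T p).trace.re = ∑ i ∈ Finset.range m, lam i ^ (p / 2) := by
  have hpos : (Tᴴ * T).PosSemidef := posSemidef_conjTranspose_mul_self T
  set e := hpos.isHermitian.eigenvalues with he
  set V : Matrix (Fin m) (Fin m) ℂ := hpos.isHermitian.eigenvectorUnitary.val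
  have hVV : Vᴴ * V = 1 := Unitary.coe_star_mul_self hpos.isHermitian.eigenvectorUnitary
  have hVV' : V * Vᴴ = 1 := Unitary.coe_mul_star_self hpos.isHermitian.eigenvectorUnitary
  set σ : Equiv.Perm (Fin m) := Tuple.sort (fun i => - e i)
  have hmono : Antitone (e ∘ σ) := fun i j hij =>
    neg_le_neg_iff.mp (Tuple.monotone_sort (fun i => - e i) hij)
  have hlam (i : Fin m) :
      (if h : (i : ℕ) < m then e (σ ⟨i, h⟩) else 0) = e (σ i) := by simp
  refine ⟨fun i => if h : i < m then e (σ ⟨i, h⟩) else 0, V.submatrix id σ, ?_, ?_, ?_, ?_, ?_, ?_⟩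
  · intro i j hij
    by_cases hj : j < m
    · simpa [hj, hij.trans_lt hj] using
        hmono (show (⟨i, hij.trans_lt hj⟩ : Fin m) ≤ ⟨j, hj⟩ from hij)
    · simp only [hj, dite_false]
      split_ifs
      · exact hpos.eigenvalues_nonneg _
      · exact le_rfl
  · intro i
    dsimp only
    split_ifs
    · exact hpos.eigenvalues_nonneg _
    · exact le_rfl
  · rw [conjTranspose_submatrix, ← submatrix_mul _ _ _ _ _ Function.bijective_id, hVV,
      submatrix_one_equiv]
  · rw [conjTranspose_submatrix, ← submatrix_mul _ _ _ _ _ σ.bijective, hVV', submatrix_id_id]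
  · simp only [hlam]
    have hd : diagonal (fun i : Fin m => ((e (σ i) : ℝ) : ℂ)) =
        (diagonal (fun i : Fin m => ((e i : ℝ) : ℂ))).submatrix σ σ := by
      rw [submatrix_diagonal_equiv]
      rfl
    rw [hd, conjTranspose_submatrix, ← submatrix_mul _ _ _ _ _ σ.bijective,
      ← submatrix_mul _ _ _ _ _ σ.bijective, submatrix_id_id]
    exact hpos.isHermitian.spectral_theorem
  · intro p
    rw [Finset.sum_range]
    simp only [hlam]
    rw [Equiv.sum_comp σ (fun i => e i ^ (p / 2)), absPow, hpos.isHermitian.cfc_eq, IsHermitian.cfc,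
      Unitary.conjStarAlgAut_apply, trace_mul_cycle]
    change ((Vᴴ * V * _).trace).re = _
    rw [hVV, one_mul, trace_diagonal]
    simp [he]

section ConjTransposeMulSelf

variable {m k : ℕ} {T U : Matrix (Fin m) (Fin m) ℂ} {lam : ℕ → ℝ}

theorem re_det_gram_mul_le (hlam : Antitone lam) (h0 : ∀ i, 0 ≤ lam i) (hU : U * Uᴴ = 1)
    (hT : Tᴴ * T = U * diagonal (fun i : Fin m => (lam i : ℂ)) * Uᴴ)
    (V : Matrix (Fin m) (Fin k) ℂ) :
    ((T * V)ᴴ * (T * V)).det.re ≤ (∏ j : Fin k, lam j) * (Vᴴ * V).det.re := by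
  have h := re_det_conjTranspose_mul_diagonal_mul_le hlam h0 (Uᴴ * V)
  have h₁ : (T * V)ᴴ * (T * V) =
      (Uᴴ * V)ᴴ * (diagonal (fun i : Fin m => (lam i : ℂ)) * (Uᴴ * V)) := by
    rw [conjTranspose_mul, Matrix.mul_assoc, ← Matrix.mul_assoc Tᴴ, hT]
    simp [Matrix.mul_assoc]
  have h₂ : Vᴴ * V = (Uᴴ * V)ᴴ * (Uᴴ * V) := by
    rw [conjTranspose_mul, conjTranspose_conjTranspose, Matrix.mul_assoc, ← Matrix.mul_assoc U,
      hU, Matrix.one_mul]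
  rw [h₁, h₂]
  exact h

theorem re_det_gram_pow_mul_le (hlam : Antitone lam) (h0 : ∀ i, 0 ≤ lam i) (hU : U * Uᴴ = 1)
    (hT : Tᴴ * T = U * diagonal (fun i : Fin m => (lam i : ℂ)) * Uᴴ) (n : ℕ)
    (V : Matrix (Fin m) (Fin k) ℂ) :
    ((T ^ n * V)ᴴ * (T ^ n * V)).det.re ≤ (∏ j : Fin k, lam j) ^ n * (Vᴴ * V).det.re := by
  induction n generalizing V with
  | zero => simp
  | succ n ih =>
    rw [pow_succ T, Matrix.mul_assoc, pow_succ, mul_assoc]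
    exact (ih (T * V)).trans (mul_le_mul_of_nonneg_left (re_det_gram_mul_le hlam h0 hU hT V)
      (pow_nonneg (Finset.prod_nonneg fun _ _ => h0 _) n))

theorem exists_re_det_gram_mul_eq (hk : k ≤ m) (hU : Uᴴ * U = 1)
    (hT : Tᴴ * T = U * diagonal (fun i : Fin m => (lam i : ℂ)) * Uᴴ) :
    ∃ V : Matrix (Fin m) (Fin k) ℂ, Vᴴ * V = 1 ∧
      ((T * V)ᴴ * (T * V)).det.re = ∏ j : Fin k, lam j := by
  have hinj := Fin.castLE_injective hk
  refine ⟨U.submatrix id (Fin.castLE hk), ?_, ?_⟩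
  · rw [conjTranspose_submatrix, ← submatrix_mul _ _ _ _ _ Function.bijective_id, hU,
      submatrix_one _ hinj]
  · have h : (T * U.submatrix id (Fin.castLE hk))ᴴ * (T * U.submatrix id (Fin.castLE hk)) =
        (Uᴴ * (Tᴴ * T) * U).submatrix (Fin.castLE hk) (Fin.castLE hk) := by
      rw [← submatrix_id_id T, ← submatrix_mul _ _ _ _ _ Function.bijective_id,
        conjTranspose_submatrix, ← submatrix_mul _ _ _ _ _ Function.bijective_id,
        conjTranspose_mul]
      simp [Matrix.mul_assoc]
    have hd : Uᴴ * (Tᴴ * T) * U = diagonal (fun i : Fin m => (lam i : ℂ)) := by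
      rw [hT]
      calc _ = (Uᴴ * U) * diagonal (fun i : Fin m => (lam i : ℂ)) * (Uᴴ * U) := by
            simp only [Matrix.mul_assoc]
        _ = _ := by rw [hU, Matrix.one_mul, Matrix.mul_one]
    rw [h, hd, submatrix_diagonal _ _ hinj, det_diagonal]
    simp [← Complex.ofReal_prod]

end ConjTransposeMulSelf

/-- For nonnegative sequences, weak log-majorization implies weak majorization. -/
theorem sum_le_sum_of_prod_le_prod {x y : ℕ → ℝ} (hx : Antitone x) (hx0 : ∀ i, 0 ≤ x i)
    (hy0 : ∀ i, 0 ≤ y i) (m : ℕ)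
    (h : ∀ k ≤ m, ∏ i ∈ Finset.range k, x i ≤ ∏ i ∈ Finset.range k, y i) :
    ∑ i ∈ Finset.range m, x i ≤ ∑ i ∈ Finset.range m, y i := by
  induction m with
  | zero => simp
  | succ m ih =>
    rcases (hx0 m).eq_or_lt with hm | hm
    · rw [Finset.sum_range_succ, Finset.sum_range_succ, ← hm]
      exact add_le_add (ih fun k hk => h k (by omega)) (hy0 m)
    have hxp (i : ℕ) (hi : i < m + 1) : 0 < x i := hm.trans_le (hx (by omega))
    have hyp (i : ℕ) (hi : i < m + 1) : 0 < y i := by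
      refine (hy0 i).lt_of_ne' fun h0 => ?_
      have hprod := h (m + 1) le_rfl
      rw [Finset.prod_eq_zero (Finset.mem_range.mpr hi) h0] at hprod
      exact hprod.not_gt (Finset.prod_pos fun j hj => hxp j (Finset.mem_range.mp hj))
    have hlog (k : ℕ) (hk : k ≤ m + 1) :
        0 ≤ ∑ i ∈ Finset.range k, (Real.log (y i) - Real.log (x i)) := by
      have hxk : ∀ i ∈ Finset.range k, 0 < x i := fun i hi =>
        hxp i ((Finset.mem_range.mp hi).trans_le hk)
      have hyk : ∀ i ∈ Finset.range k, 0 < y i := fun i hi =>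
        hyp i ((Finset.mem_range.mp hi).trans_le hk)
      rw [Finset.sum_sub_distrib, ← Real.log_prod fun i hi => (hxk i hi).ne',
        ← Real.log_prod fun i hi => (hyk i hi).ne', sub_nonneg]
      exact Real.log_le_log (Finset.prod_pos hxk) (h k hk)
    have habel (k : ℕ) (hk : k ≤ m + 1) :
        x k * ∑ i ∈ Finset.range k, (Real.log (y i) - Real.log (x i)) ≤
          ∑ i ∈ Finset.range k, x i * (Real.log (y i) - Real.log (x i)) := by
      induction k with
      | zero => simp
      | succ k ihk =>
        refine (mul_le_mul_of_nonneg_right (hx k.le_succ) (hlog (k + 1) hk)).trans ?_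
        rw [Finset.sum_range_succ, Finset.sum_range_succ, mul_add]
        exact add_le_add_left (ihk (by omega)) _
    rw [← sub_nonneg, ← Finset.sum_sub_distrib]
    refine ((mul_nonneg (hx0 _) (hlog _ le_rfl)).trans (habel _ le_rfl)).trans
      (Finset.sum_le_sum fun i hi => ?_)
    have hxi := hxp i (Finset.mem_range.mp hi)
    have hyi := hyp i (Finset.mem_range.mp hi)
    rw [← Real.log_div hyi.ne' hxi.ne']
    calc x i * Real.log (y i / x i) ≤ x i * (y i / x i - 1) :=
          mul_le_mul_of_nonneg_left (Real.log_le_sub_one_of_pos (div_pos hyi hxi)) hxi.le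
      _ = y i - x i := by field_simp

/-- Let A ∈ M_m(ℂ). For every n ≥ 1 and p ∈ (0, ∞), tr(|A^n|^{p/n}) ≤ tr(|A|^p). -/
theorem trace_rpow_abs_pow_le (m : ℕ) (A : Matrix (Fin m) (Fin m) ℂ)
    (n : ℕ) (hn : 1 ≤ n) (p : ℝ) (hp : 0 < p) :
    (Matrix.trace (absPow (A ^ n) (p / n))).re ≤ (Matrix.trace (absPow A p)).re := by
  obtain ⟨lam, U, hlam, hlam0, -, hU, hA, htr⟩ := exists_antitone_spectral_decomposition A
  obtain ⟨mu, W, hmu, hmu0, hW, -, hAn, htrn⟩ := exists_antitone_spectral_decomposition (A ^ n)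
  have hn0 : (0 : ℝ) < n := by exact_mod_cast hn
  rw [htr, htrn]
  refine sum_le_sum_of_prod_le_prod
    (fun i j hij => Real.rpow_le_rpow (hmu0 j) (hmu hij) (by positivity))
    (fun i => Real.rpow_nonneg (hmu0 i) _) (fun i => Real.rpow_nonneg (hlam0 i) _) m
    fun k hk => ?_
  obtain ⟨V, hV, hdet⟩ := exists_re_det_gram_mul_eq hk hW hAn
  have hle := re_det_gram_pow_mul_le hlam hlam0 hU hA n V
  rw [hdet, hV, det_one, Complex.one_re, mul_one, ← Finset.prod_range, ← Finset.prod_range] at hle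
  have hprod : 0 ≤ ∏ i ∈ Finset.range k, lam i := Finset.prod_nonneg fun i _ => hlam0 i
  rw [Real.finsetProd_rpow _ _ fun i _ => hmu0 i, Real.finsetProd_rpow _ _ fun i _ => hlam0 i]
  refine (Real.rpow_le_rpow (Finset.prod_nonneg fun i _ => hmu0 i) hle (by positivity)).trans_eq ?_
  rw [← Real.rpow_natCast, ← Real.rpow_mul hprod]
  congr 1
  field_simp
end

section
/- Let H be a positive-semidefinite matrix in M_m(ℂ), let α ∈ [0, 1], and let x ∈ ℂ^m be a unit vector. Then ‖H^α x‖ ≤ ‖H x‖^α. -/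
open Filter Matrix Polynomial
open scoped ComplexOrder

/-- The functional calculus of a Hermitian matrix acts on an eigenvector through its eigenvalue. -/
lemma Matrix.IsHermitian.toEuclideanCLM_cfc_eigenvectorBasis {n : Type*} [Fintype n]
    [DecidableEq n] {A : Matrix n n ℂ} (hA : A.IsHermitian) (f : ℝ → ℝ) (j : n) :
    toEuclideanCLM (𝕜 := ℂ) (cfc f A) (hA.eigenvectorBasis j) =
      (f (hA.eigenvalues j) : ℂ) • hA.eigenvectorBasis j := by
  apply WithLp.ofLp_injective
  rw [ofLp_toEuclideanCLM, hA.cfc_eq, IsHermitian.cfc, Unitary.conjStarAlgAut_apply,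
    ← mulVec_mulVec, ← mulVec_mulVec, hA.star_eigenvectorUnitary_mulVec, diagonal_mulVec_single,
    mul_one, WithLp.ofLp_smul, ← hA.eigenvectorUnitary_mulVec, ← mulVec_smul]
  congr 1
  simp [← Pi.single_smul]

/-- The squared norm of `f(A) x` as a weighted sum over the eigenvalues of `A`. -/
lemma Matrix.IsHermitian.norm_sq_toEuclideanCLM_cfc_apply {n : Type*} [Fintype n]
    [DecidableEq n] {A : Matrix n n ℂ} (hA : A.IsHermitian) (f : ℝ → ℝ)
    (x : EuclideanSpace ℂ n) :
    ‖toEuclideanCLM (𝕜 := ℂ) (cfc f A) x‖ ^ 2 =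
      ∑ i, ‖inner ℂ (hA.eigenvectorBasis i) x‖ ^ 2 * f (hA.eigenvalues i) ^ 2 := by
  have hsum : toEuclideanCLM (𝕜 := ℂ) (cfc f A) x =
      ∑ i, (inner ℂ (hA.eigenvectorBasis i) x * (f (hA.eigenvalues i) : ℂ)) •
        hA.eigenvectorBasis i := by
    conv_lhs => rw [← hA.eigenvectorBasis.sum_repr' x]
    simp only [map_sum, map_smul, hA.toEuclideanCLM_cfc_eigenvectorBasis, smul_smul]
  rw [← hA.eigenvectorBasis.sum_sq_norm_inner_right, hsum]
  refine Finset.sum_congr rfl fun i _ ↦ ?_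
  rw [hA.eigenvectorBasis.orthonormal.inner_right_fintype, norm_mul, mul_pow, Complex.norm_real,
    Real.norm_eq_abs, sq_abs]

/-- Let H ∈ M_m(ℂ) be positive-semidefinite, α ∈ [0, 1], and x ∈ ℂ^m a unit vector. Then
‖H^α x‖ ≤ ‖H x‖^α, where H^α is the α-th power of H by functional calculus. -/
theorem norm_psd_rpow_apply_le (m : ℕ) (H : Matrix (Fin m) (Fin m) ℂ)
    (hH : H.PosSemidef) (α : ℝ) (hα : α ∈ Set.Icc (0 : ℝ) 1)
    (x : EuclideanSpace ℂ (Fin m)) (hx : ‖x‖ = 1) :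
    ‖toEuclideanCLM (𝕜 := ℂ) (cfc (fun t : ℝ => t ^ α) H) x‖ ≤
      ‖toEuclideanCLM (𝕜 := ℂ) H x‖ ^ α := by
  have hA := hH.isHermitian
  have hnorm : ‖toEuclideanCLM (𝕜 := ℂ) H x‖ ^ 2 =
      ∑ i, ‖inner ℂ (hA.eigenvectorBasis i) x‖ ^ 2 * hA.eigenvalues i ^ 2 := by
    simpa only [cfc_id' ℝ H hA.isSelfAdjoint] using
      hA.norm_sq_toEuclideanCLM_cfc_apply (fun t ↦ t) x
  have hweights : ∑ i, ‖inner ℂ (hA.eigenvectorBasis i) x‖ ^ 2 = 1 := by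
    rw [hA.eigenvectorBasis.sum_sq_norm_inner_right, hx, one_pow]
  have hjensen := (Real.concaveOn_rpow hα.1 hα.2).le_map_sum (t := Finset.univ)
    (p := fun i ↦ hA.eigenvalues i ^ 2) (fun i _ ↦ sq_nonneg _) hweights
    (fun i _ ↦ Set.mem_Ici.2 (sq_nonneg _))
  simp only [smul_eq_mul] at hjensen
  refine le_of_pow_le_pow_left₀ two_ne_zero (by positivity) ?_
  rw [hA.norm_sq_toEuclideanCLM_cfc_apply, Real.rpow_pow_comm (norm_nonneg _), hnorm]
  simpa only [Real.rpow_pow_comm (hH.eigenvalues_nonneg _)] using hjensen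
end

section
/- Let A ∈ M_m(ℂ) with eigenvalues λ_1, ..., λ_m counted with multiplicity. Then for every 0 < p < ∞, ∑_{i=1}^m |λ_i|^p = lim_{n → ∞} tr(|A^n|^{p/n}). -/
open Filter Matrix Polynomial

section Growth

open Module

variable {V : Type*} [NormedAddCommGroup V] [NormedSpace ℂ V] [FiniteDimensional ℂ V]

/-- If all eigenvalues of `f` have modulus less than `R`, then `f ^ n` eventually has operator norm
less than `R ^ n`. -/
theorem eventually_norm_pow_apply_lt (f : End ℂ V) {R : ℝ} (hR : 0 < R)
    (hf : ∀ z, f.HasEigenvalue z → ‖z‖ < R) :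
    ∀ᶠ n : ℕ in atTop, ∀ x ≠ 0, ‖(f ^ n) x‖ < R ^ n * ‖x‖ := by
  rcases subsingleton_or_nontrivial V with hV | hV
  · exact .of_forall fun n x hx => (hx (Subsingleton.elim _ _)).elim
  have : CompleteSpace V := FiniteDimensional.complete ℂ V
  set a : V →L[ℂ] V := Module.End.toContinuousLinearMap V f with ha
  have hpow (n : ℕ) (x : V) : (f ^ n) x = (a ^ n) x := by
    rw [ha, ← map_pow]; rfl
  have hrad : spectralRadius ℂ a < (R.toNNReal : ENNReal) := by
    refine spectrum.spectralRadius_lt_of_forall_lt a fun z hz => ?_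
    rw [ha, AlgEquiv.spectrum_eq, ← End.hasEigenvalue_iff_mem_spectrum] at hz
    rw [← NNReal.coe_lt_coe, Real.coe_toNNReal _ hR.le]
    exact hf z hz
  have hlim := (spectrum.pow_norm_pow_one_div_tendsto_nhds_spectralRadius a).eventually_lt_const
    hrad
  filter_upwards [hlim, eventually_gt_atTop 0] with n hn hn0 x hx
  have hn' : ‖a ^ n‖ ^ (1 / n : ℝ) < R := (ENNReal.ofReal_lt_ofReal_iff hR).1 hn
  have hlt : ‖a ^ n‖ < R ^ n := by
    have := pow_lt_pow_left₀ hn' (by positivity) hn0.ne'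
    rwa [one_div, Real.rpow_inv_natCast_pow (norm_nonneg _) hn0.ne'] at this
  rw [hpow]
  exact ((a ^ n).le_opNorm x).trans_lt (by have := norm_pos_iff.2 hx; gcongr)

/-- If all eigenvalues of `f` have modulus greater than `R`, then `f ^ n` eventually expands all
vectors by a factor of more than `R ^ n`. -/
theorem eventually_lt_norm_pow_apply (f : End ℂ V) {R : ℝ} (hR : 0 < R)
    (hf : ∀ z, f.HasEigenvalue z → R < ‖z‖) :
    ∀ᶠ n : ℕ in atTop, ∀ x ≠ 0, R ^ n * ‖x‖ < ‖(f ^ n) x‖ := by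
  have hu : IsUnit f := by
    by_contra h
    have h0 : f.HasEigenvalue 0 := by
      rw [End.hasEigenvalue_iff_mem_spectrum, spectrum.zero_mem_iff]
      exact h
    simpa using hR.trans (hf 0 h0)
  obtain ⟨u, rfl⟩ := hu
  have hinv : ∀ z, (↑u⁻¹ : End ℂ V).HasEigenvalue z → ‖z‖ < R⁻¹ := by
    intro z hz
    obtain ⟨v, hv⟩ := hz.exists_hasEigenvector
    have hv1 : v = z • (u : End ℂ V) v := by
      rw [← map_smul, ← hv.apply_eq_smul, ← Module.End.mul_apply, u.mul_inv, Module.End.one_apply]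
    have hz0 : z ≠ 0 := by
      rintro rfl
      exact hv.2 (by simpa using hv1)
    have : (u : End ℂ V).HasEigenvalue z⁻¹ :=
      End.hasEigenvalue_of_hasEigenvector (x := v)
        ⟨End.mem_eigenspace_iff.2 (by rw [eq_inv_smul_iff₀ hz0]; exact hv1.symm), hv.2⟩
    have := hf _ this
    rw [norm_inv] at this
    exact (lt_inv_comm₀ hR (norm_pos_iff.2 hz0)).1 this
  filter_upwards [eventually_norm_pow_apply_lt _ (inv_pos.2 hR) hinv] with n hn x hx
  have hux : (↑u⁻¹ ^ n : End ℂ V) ((↑u ^ n : End ℂ V) x) = x := by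
    rw [← Module.End.mul_apply, ← Units.val_pow_eq_pow_val, ← Units.val_pow_eq_pow_val,
      ← Units.val_mul, inv_pow, inv_mul_cancel, Units.val_one, Module.End.one_apply]
  have h := hn ((↑u ^ n : End ℂ V) x) fun h0 => hx (by rw [← hux, h0, map_zero])
  rw [hux, inv_pow, lt_inv_mul_iff₀ (by positivity)] at h
  exact h

end Growth

section SpectralSubspace

open Module

variable {V : Type*} [AddCommGroup V] [Module ℂ V]

/-- The sum of the generalized eigenspaces of `f` over the scalars in `s`. -/
def spectralSubspace (f : End ℂ V) (s : Finset ℂ) : Submodule ℂ V :=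
  ⨆ z ∈ s, f.maxGenEigenspace z

theorem mapsTo_spectralSubspace (f : End ℂ V) (s : Finset ℂ) :
    Set.MapsTo f (spectralSubspace f s) (spectralSubspace f s) :=
  LinearMap.mapsTo_biSup_of_mapsTo (s : Set ℂ)
    fun z => f.mapsTo_maxGenEigenspace_of_comm (Commute.refl f) z

theorem mem_of_hasEigenvalue_restrict_spectralSubspace (f : End ℂ V) (s : Finset ℂ) {z : ℂ}
    (hz : End.HasEigenvalue (f.restrict (mapsTo_spectralSubspace f s)) z) : z ∈ s := by
  by_contra hzs
  obtain ⟨v, hv⟩ := hz.exists_hasEigenvector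
  have hd : Disjoint (f.maxGenEigenspace z) (spectralSubspace f s) :=
    f.independent_maxGenEigenspace.disjoint_biSup (y := (s : Set ℂ)) hzs
  have hvz : (v : V) ∈ f.eigenspace z := by
    rw [End.mem_eigenspace_iff]
    exact congrArg Subtype.val hv.apply_eq_smul
  refine hv.2 (Subtype.ext (Submodule.disjoint_def.1 hd v ?_ v.2))
  exact (f.genEigenspace z).mono le_top hvz

theorem finrank_spectralSubspace_le_sum [FiniteDimensional ℂ V] (f : End ℂ V) (s : Finset ℂ) :
    finrank ℂ (spectralSubspace f s) ≤ ∑ z ∈ s, f.charpoly.rootMultiplicity z := by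
  induction s using Finset.induction_on with
  | empty =>
    have : spectralSubspace f ∅ = ⊥ := by simp [spectralSubspace]
    simp [this]
  | insert z s hz ih =>
    rw [Finset.sum_insert hz, spectralSubspace, Finset.iSup_insert]
    exact (Submodule.finrank_add_le_finrank_add_finrank _ _).trans
      (add_le_add (f.finrank_maxGenEigenspace_eq z).le ih)

variable [FiniteDimensional ℂ V] {ι : Type*} [Fintype ι]

theorem rootMultiplicity_prod_X_sub_C (μ : ι → ℂ) (z : ℂ) :
    (∏ i, (X - C (μ i))).rootMultiplicity z = (Finset.univ.filter fun i => μ i = z).card := by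
  classical
  have h : (∏ i, (X - C (μ i))) = ((Finset.univ.val.map μ).map fun a => X - C a).prod := by
    rw [Multiset.map_map]; rfl
  rw [← count_roots, h, roots_multiset_prod_X_sub_C, Multiset.count_map, Finset.card_def]
  simp only [Finset.filter_val, eq_comm]

theorem finrank_spectralSubspace_le (f : End ℂ V) (μ : ι → ℂ)
    (hμ : f.charpoly = ∏ i, (X - C (μ i))) (s : Finset ℂ) :
    finrank ℂ (spectralSubspace f s) ≤ (Finset.univ.filter fun i => μ i ∈ s).card := by
  classical
  refine (finrank_spectralSubspace_le_sum f s).trans_eq ?_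
  rw [Finset.card_eq_sum_card_fiberwise (f := μ) (t := s) (fun i hi => by simpa using hi)]
  refine Finset.sum_congr rfl fun z hz => ?_
  rw [hμ, rootMultiplicity_prod_X_sub_C, Finset.filter_filter]
  congr 1
  ext i
  simp only [Finset.mem_filter, Finset.mem_univ, true_and]
  exact ⟨fun h => ⟨h ▸ hz, h⟩, And.right⟩

theorem spectralSubspace_sup_eq_top (f : End ℂ V) (μ : ι → ℂ)
    (hμ : f.charpoly = ∏ i, (X - C (μ i))) (s t : Finset ℂ) (hst : ∀ i, μ i ∈ s ∨ μ i ∈ t) :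
    spectralSubspace f s ⊔ spectralSubspace f t = ⊤ := by
  rw [eq_top_iff, ← f.iSup_maxGenEigenspace_eq_top, iSup_le_iff]
  intro z
  by_cases hz : ∃ i, μ i = z
  · obtain ⟨i, rfl⟩ := hz
    rcases hst i with h | h
    · exact (le_biSup f.maxGenEigenspace h).trans le_sup_left
    · exact (le_biSup f.maxGenEigenspace h).trans le_sup_right
  · have : finrank ℂ (f.maxGenEigenspace z) = 0 := by
      rw [f.finrank_maxGenEigenspace_eq, hμ, rootMultiplicity_prod_X_sub_C, Finset.card_eq_zero,
        Finset.filter_eq_empty_iff]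
      exact fun i _ hi => hz ⟨i, hi⟩
    rw [Submodule.finrank_eq_zero.1 this]
    exact bot_le

end SpectralSubspace

section SingularValues

open Module

variable {m : ℕ}

/-- The eigenvalues of `TᴴT`, that is, the squared singular values of `T`. -/
noncomputable def sqSingularValues (T : Matrix (Fin m) (Fin m) ℂ) : Fin m → ℝ :=
  (isHermitian_conjTranspose_mul_self T).eigenvalues

theorem sqSingularValues_nonneg (T : Matrix (Fin m) (Fin m) ℂ) (i : Fin m) :
    0 ≤ sqSingularValues T i :=
  eigenvalues_conjTranspose_mul_self_nonneg T i

theorem trace_absPow (T : Matrix (Fin m) (Fin m) ℂ) (p : ℝ) :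
    (absPow T p).trace.re = ∑ i, sqSingularValues T i ^ (p / 2) := by
  rw [absPow, (isHermitian_conjTranspose_mul_self T).cfc_eq, IsHermitian.cfc,
    Unitary.conjStarAlgAut_apply, trace_mul_cycle]
  simp [trace_diagonal, sqSingularValues]

theorem sq_norm_toEuclideanLin_apply (T : Matrix (Fin m) (Fin m) ℂ)
    (x : EuclideanSpace ℂ (Fin m)) :
    ‖toEuclideanLin T x‖ ^ 2 = ∑ i, sqSingularValues T i *
      ‖inner ℂ ((isHermitian_conjTranspose_mul_self T).eigenvectorBasis i) x‖ ^ 2 := by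
  set hT := isHermitian_conjTranspose_mul_self T
  set b := hT.eigenvectorBasis with hb
  have hsymm : (toEuclideanLin (Tᴴ * T)).IsSymmetric := isSymmetric_toEuclideanLin_iff.2 hT
  have hbi (i : Fin m) : toEuclideanLin (Tᴴ * T) (b i) = (hT.eigenvalues i : ℂ) • b i := by
    have := hT.mulVec_eigenvectorBasis i
    ext j
    simpa [toLpLin_apply] using congrFun this j
  have h1 : inner ℂ (toEuclideanLin T x) (toEuclideanLin T x)
      = inner ℂ x (toEuclideanLin (Tᴴ * T) x) := by
    have h2 : toEuclideanLin (Tᴴ * T) x = (toEuclideanLin T).adjoint (toEuclideanLin T x) := by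
      rw [← toEuclideanLin_conjTranspose_eq_adjoint]
      simp [toLpLin_apply]
    rw [h2, LinearMap.adjoint_inner_right]
  have h3 : ((‖toEuclideanLin T x‖ ^ 2 : ℝ) : ℂ)
      = ((∑ i, sqSingularValues T i * ‖inner ℂ (b i) x‖ ^ 2 : ℝ) : ℂ) := by
    have h4 := inner_self_eq_norm_sq_to_K (𝕜 := ℂ) (toEuclideanLin T x)
    rw [h1, ← b.sum_inner_mul_inner] at h4
    push_cast
    refine Eq.trans h4.symm (Finset.sum_congr rfl fun i _ => ?_)
    rw [← hsymm, hbi, inner_smul_left, ← inner_conj_symm x (b i)]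
    have h5 := RCLike.conj_mul (inner ℂ (b i) x)
    simp only [Complex.conj_ofReal, sqSingularValues]
    rw [mul_left_comm, h5]
    rfl
  exact_mod_cast h3

/-- A subspace on which `x ↦ ⟪b i, x⟫`, `i ∈ S`, are jointly injective has dimension at most
`#S`. -/
theorem finrank_le_card_of_inner_eq_zero
    (b : OrthonormalBasis (Fin m) ℂ (EuclideanSpace ℂ (Fin m)))
    (S : Finset (Fin m)) (E : Submodule ℂ (EuclideanSpace ℂ (Fin m)))
    (hE : ∀ x ∈ E, (∀ i ∈ S, inner ℂ (b i) x = 0) → x = 0) :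
    finrank ℂ E ≤ S.card := by
  let L : E →ₗ[ℂ] (S → ℂ) :=
    LinearMap.pi fun i => (innerSL ℂ (b i)).toLinearMap ∘ₗ E.subtype
  have hL : Function.Injective L := by
    rw [← LinearMap.ker_eq_bot, LinearMap.ker_eq_bot']
    intro x hx
    exact Subtype.ext (hE x x.2 fun i hi => congrFun hx ⟨i, hi⟩)
  simpa using LinearMap.finrank_le_finrank_of_injective hL

theorem finrank_le_card_of_lt_norm (T : Matrix (Fin m) (Fin m) ℂ) {c : ℝ} (hc : 0 ≤ c)
    (E : Submodule ℂ (EuclideanSpace ℂ (Fin m)))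
    (hE : ∀ x ∈ E, x ≠ 0 → c * ‖x‖ < ‖toEuclideanLin T x‖) :
    finrank ℂ E ≤ (Finset.univ.filter fun i => c ^ 2 < sqSingularValues T i).card := by
  refine finrank_le_card_of_inner_eq_zero
    (isHermitian_conjTranspose_mul_self T).eigenvectorBasis _ E fun x hx h => ?_
  by_contra hx0
  have h1 := pow_lt_pow_left₀ (hE x hx hx0) (by positivity) two_ne_zero
  rw [sq_norm_toEuclideanLin_apply, mul_pow, ← OrthonormalBasis.sum_sq_norm_inner_right
    (isHermitian_conjTranspose_mul_self T).eigenvectorBasis, Finset.mul_sum] at h1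
  refine h1.not_ge (Finset.sum_le_sum fun i _ => ?_)
  by_cases hi : c ^ 2 < sqSingularValues T i
  · simp [h i (by simpa using hi)]
  · have := not_lt.1 hi
    gcongr

theorem finrank_le_card_of_norm_lt (T : Matrix (Fin m) (Fin m) ℂ) {c : ℝ}
    (E : Submodule ℂ (EuclideanSpace ℂ (Fin m)))
    (hE : ∀ x ∈ E, x ≠ 0 → ‖toEuclideanLin T x‖ < c * ‖x‖) :
    finrank ℂ E ≤ (Finset.univ.filter fun i => ¬ c ^ 2 < sqSingularValues T i).card := by
  refine finrank_le_card_of_inner_eq_zero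
    (isHermitian_conjTranspose_mul_self T).eigenvectorBasis _ E fun x hx h => ?_
  by_contra hx0
  have h1 := pow_lt_pow_left₀ (hE x hx hx0) (by positivity) two_ne_zero
  rw [sq_norm_toEuclideanLin_apply, mul_pow, ← OrthonormalBasis.sum_sq_norm_inner_right
    (isHermitian_conjTranspose_mul_self T).eigenvectorBasis, Finset.mul_sum] at h1
  refine h1.not_ge (Finset.sum_le_sum fun i _ => ?_)
  by_cases hi : c ^ 2 < sqSingularValues T i
  · gcongr
  · simp [h i (by simpa using hi)]

/-- If no eigenvalue of `A` has modulus `R`, then for large `n` the number of singular values of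
`A ^ n` exceeding `R ^ n` is the number of eigenvalues of modulus exceeding `R`. -/
theorem eventually_card_lt_sqSingularValues (A : Matrix (Fin m) (Fin m) ℂ)
    (μ : Fin m → ℂ) (hμ : A.charpoly = ∏ i, (X - C (μ i))) {R : ℝ} (hR : 0 < R)
    (hRμ : ∀ i, ‖μ i‖ ≠ R) :
    ∀ᶠ n : ℕ in atTop,
      (Finset.univ.filter fun i => (R ^ n) ^ 2 < sqSingularValues (A ^ n) i).card
        = (Finset.univ.filter fun i => R < ‖μ i‖).card := by
  classical
  set f : End ℂ (EuclideanSpace ℂ (Fin m)) := toEuclideanLin A with hf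
  have hfμ : f.charpoly = ∏ i, (X - C (μ i)) := by
    rw [hf, toEuclideanLin_eq_toLin_orthonormal, Matrix.charpoly_toLin, hμ]
  have hpow (n : ℕ) : toEuclideanLin (A ^ n) = f ^ n := by
    induction n with
    | zero => ext; simp
    | succ n ih =>
      rw [pow_succ', pow_succ', ← ih]
      ext
      simp [hf]
  set s : Finset ℂ := (Finset.univ.image μ).filter fun z => R < ‖z‖ with hs
  set t : Finset ℂ := (Finset.univ.image μ).filter fun z => ¬ R < ‖z‖ with ht
  have hmem (u : Finset ℂ) (n : ℕ) (x : EuclideanSpace ℂ (Fin m)) (hx : x ∈ spectralSubspace f u) :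
      (((f.restrict (mapsTo_spectralSubspace f u)) ^ n) ⟨x, hx⟩ : EuclideanSpace ℂ (Fin m))
        = toEuclideanLin (A ^ n) x := by
    rw [hpow]
    exact congrArg Subtype.val
      (congrArg (· ⟨x, hx⟩) (Module.End.pow_restrict n (mapsTo_spectralSubspace f u)))
  have hE := eventually_lt_norm_pow_apply (f.restrict (mapsTo_spectralSubspace f s)) hR
    fun z hz => by
      have := mem_of_hasEigenvalue_restrict_spectralSubspace f s hz
      exact (Finset.mem_filter.1 this).2
  have hF := eventually_norm_pow_apply_lt (f.restrict (mapsTo_spectralSubspace f t)) hR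
    fun z hz => by
      have := mem_of_hasEigenvalue_restrict_spectralSubspace f t hz
      obtain ⟨h1, h2⟩ := Finset.mem_filter.1 this
      obtain ⟨i, -, rfl⟩ := Finset.mem_image.1 h1
      exact lt_of_le_of_ne (not_lt.1 h2) (hRμ i)
  filter_upwards [hE, hF] with n hEn hFn
  have h1 := finrank_le_card_of_lt_norm (A ^ n) (pow_nonneg hR.le n) (spectralSubspace f s)
    fun x hx hx0 => by
      have := hEn ⟨x, hx⟩ fun h => hx0 (congrArg Subtype.val h)
      rwa [Submodule.coe_norm, Submodule.coe_norm, hmem] at this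
  have h2 := finrank_le_card_of_norm_lt (A ^ n) (c := R ^ n) (spectralSubspace f t)
    fun x hx hx0 => by
      have := hFn ⟨x, hx⟩ fun h => hx0 (congrArg Subtype.val h)
      rwa [Submodule.coe_norm, Submodule.coe_norm, hmem] at this
  have h3 := finrank_spectralSubspace_le f μ hfμ s
  have h4 := finrank_spectralSubspace_le f μ hfμ t
  have h5 := Submodule.finrank_add_le_finrank_add_finrank
    (spectralSubspace f s) (spectralSubspace f t)
  rw [spectralSubspace_sup_eq_top f μ hfμ s t fun i => by
      by_cases h : R < ‖μ i‖ <;> simp [hs, ht, h, le_of_not_gt], finrank_top, finrank_euclideanSpace,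
    Fintype.card_fin] at h5
  have h6 := Finset.card_filter_add_card_filter_not (s := (Finset.univ : Finset (Fin m)))
    fun i => (R ^ n) ^ 2 < sqSingularValues (A ^ n) i
  have h7 := Finset.card_filter_add_card_filter_not (s := (Finset.univ : Finset (Fin m)))
    fun i => R < ‖μ i‖
  simp only [hs, ht, Finset.mem_filter, Finset.mem_image, Finset.mem_univ, true_and,
    exists_apply_eq_apply] at h3 h4
  rw [Finset.card_univ, Fintype.card_fin] at h6 h7
  lia

end SingularValues

section Sorting

variable {m : ℕ}

theorem Monotone.lt_apply_iff_card {g : Fin m → ℝ} (hg : Monotone g) (i : Fin m) (R : ℝ) :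
    R < g i ↔ m - i ≤ (Finset.univ.filter fun j => R < g j).card := by
  constructor
  · intro h
    rw [← Fin.card_Ici]
    refine Finset.card_le_card fun j hj => ?_
    simpa using h.trans_le (hg (Finset.mem_Ici.1 hj))
  · intro h
    by_contra hi
    have h1 : (Finset.univ.filter fun j => R < g j).card ≤ (Finset.Ioi i).card := by
      refine Finset.card_le_card fun j hj => Finset.mem_Ioi.2 (lt_of_not_ge fun hji => hi ?_)
      exact (Finset.mem_filter.1 hj).2.trans_le (hg hji)
    rw [Fin.card_Ioi] at h1
    have := i.2
    lia

theorem card_filter_lt_comp_perm (g : Fin m → ℝ) (σ : Equiv.Perm (Fin m)) (R : ℝ) :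
    (Finset.univ.filter fun i => R < (g ∘ σ) i).card
      = (Finset.univ.filter fun i => R < g i).card :=
  Finset.card_bij (fun i _ => σ i) (by simp) (by simp)
    fun i hi => ⟨σ.symm i, by simpa using hi, by simp⟩

/-- If the number of entries of `f n` above each level `R > 0` not attained by `g` is eventually
the same as for `g`, then the sorted entries of `f n` converge to those of `g`. -/
theorem tendsto_sort_of_eventually_card_eq (f : ℕ → Fin m → ℝ) (g : Fin m → ℝ)
    (hf : ∀ n i, 0 ≤ f n i) (hg : ∀ i, 0 ≤ g i)
    (h : ∀ R > 0, (∀ i, g i ≠ R) → ∀ᶠ n in atTop,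
      (Finset.univ.filter fun i => R < f n i).card = (Finset.univ.filter fun i => R < g i).card)
    (i : Fin m) :
    Tendsto (fun n => (f n ∘ Tuple.sort (f n)) i) atTop (nhds ((g ∘ Tuple.sort g) i)) := by
  have hex (a b : ℝ) (ha : 0 ≤ a) (hab : a < b) : ∃ R, a < R ∧ R < b ∧ ∀ i, g i ≠ R := by
    obtain ⟨R, hR, hR'⟩ := (Set.Ioo_infinite hab).exists_notMem_finite (Set.finite_range g)
    exact ⟨R, hR.1, hR.2, fun i hi => hR' ⟨i, hi⟩⟩
  have hiff (R : ℝ) (hR : 0 < R) (hRg : ∀ i, g i ≠ R) : ∀ᶠ n in atTop,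
      (R < (f n ∘ Tuple.sort (f n)) i ↔ R < (g ∘ Tuple.sort g) i) := by
    filter_upwards [h R hR hRg] with n hn
    rw [(Tuple.monotone_sort (f n)).lt_apply_iff_card, (Tuple.monotone_sort g).lt_apply_iff_card,
      card_filter_lt_comp_perm, card_filter_lt_comp_perm, hn]
  refine tendsto_order.2 ⟨fun a ha => ?_, fun b hb => ?_⟩
  · rcases lt_or_ge a 0 with ha0 | ha0
    · exact .of_forall fun n => ha0.trans_le (hf n _)
    · obtain ⟨R, h1, h2, h3⟩ := hex a _ ha0 ha
      filter_upwards [hiff R (ha0.trans_lt h1) h3] with n hn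
      exact h1.trans (hn.2 h2)
  · obtain ⟨R, h1, h2, h3⟩ := hex _ b (hg _) hb
    filter_upwards [hiff R ((hg _).trans_lt h1) h3] with n hn
    exact (not_lt.1 fun hlt => h1.not_gt (hn.1 hlt)).trans_lt h2

end Sorting

/-- Let A ∈ M_m(ℂ) with eigenvalues λ_1, ..., λ_m counted with multiplicity. Then for every
0 < p < ∞, ∑_{i=1}^m |λ_i|^p = lim_{n → ∞} tr(|A^n|^{p/n}). -/
theorem tendsto_trace_rpow_abs_pow (m : ℕ) (A : Matrix (Fin m) (Fin m) ℂ)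
    (μ : Fin m → ℂ) (hμ : A.charpoly = ∏ i, (X - C (μ i))) (p : ℝ) (hp : 0 < p) :
    Tendsto (fun n : ℕ => (Matrix.trace (absPow (A ^ n) (p / n))).re) atTop
      (nhds (∑ i, ‖μ i‖ ^ p)) := by
  let f : ℕ → Fin m → ℝ := fun n i => sqSingularValues (A ^ n) i ^ (1 / (2 * n : ℝ))
  let g : Fin m → ℝ := fun i => ‖μ i‖
  have hlim := tendsto_sort_of_eventually_card_eq f g
    (fun n i => Real.rpow_nonneg (sqSingularValues_nonneg _ i) _) (fun i => norm_nonneg _)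
    fun R hR hRg => by
      filter_upwards [eventually_card_lt_sqSingularValues A μ hμ hR hRg, eventually_gt_atTop 0]
        with n hn hn0
      rw [← hn]
      congr 1
      ext i
      have h2n : (0 : ℝ) < 2 * n := by positivity
      have hRn : (R ^ n) ^ 2 = R ^ (2 * n : ℝ) := by
        rw [← pow_mul, mul_comm, ← Real.rpow_natCast]; push_cast; rfl
      simp only [Finset.mem_filter, Finset.mem_univ, true_and, f, one_div]
      rw [hRn, Real.lt_rpow_inv_iff_of_pos hR.le (sqSingularValues_nonneg _ i) h2n]
  have hsum : Tendsto (fun n => ∑ i, (f n ∘ Tuple.sort (f n)) i ^ p) atTop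
      (nhds (∑ i, (g ∘ Tuple.sort g) i ^ p)) :=
    tendsto_finsetSum _ fun i _ => (hlim i).rpow_const (Or.inr hp.le)
  have hg : ∑ i, (g ∘ Tuple.sort g) i ^ p = ∑ i, ‖μ i‖ ^ p :=
    Equiv.sum_comp (Tuple.sort g) fun i => g i ^ p
  rw [hg] at hsum
  refine hsum.congr fun n => ?_
  rw [trace_absPow]
  refine (Equiv.sum_comp (Tuple.sort (f n)) fun i => f n i ^ p).trans
    (Finset.sum_congr rfl fun i _ => ?_)
  rw [← Real.rpow_mul (sqSingularValues_nonneg _ i)]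
  congr 1
  rw [div_div, mul_comm (n : ℝ) 2, one_div, inv_mul_eq_div]
end

section
/- Let A ∈ M_m(ℂ), and let H be a limit point of the sequence {|A^n|^{1/n}}_{n ∈ ℕ}. Then the multiset of eigenvalues of H (counted with multiplicity) equals the multiset of moduli of the eigenvalues of A (counted with multiplicity). -/
open Filter Matrix Polynomial

section OrthonormalBasis

variable {ι E : Type*} [Fintype ι] [NormedAddCommGroup E] [InnerProductSpace ℂ E]

/-- A subspace on which a diagonal quadratic form is bounded above by `t‖x‖²` has dimension at most
the number of diagonal entries that are at most `t`. -/
lemma finrank_le_card_of_quadratic_le (b : OrthonormalBasis ι ℂ E) (l : ι → ℝ) (t : ℝ)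
    (U : Submodule ℂ E) (hU : ∀ x ∈ U, ∑ i, l i * ‖b.repr x i‖ ^ 2 ≤ t * ‖x‖ ^ 2) :
    Module.finrank ℂ U ≤ (Finset.univ.filter fun i => l i ≤ t).card := by
  classical
  let g : U →ₗ[ℂ] ({i // l i ≤ t} → ℂ) :=
    { toFun := fun x i => b.repr (x : E) i
      map_add' := fun x y => by ext i; simp
      map_smul' := fun c x => by ext i; simp }
  have hg : Function.Injective g := by
    rw [← LinearMap.ker_eq_bot, LinearMap.ker_eq_bot']
    intro x hx
    have h0 : ∀ i, l i ≤ t → b.repr (x : E) i = 0 := fun i hi => congrFun hx ⟨i, hi⟩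
    have hnorm : ‖(x : E)‖ ^ 2 = ∑ i, ‖b.repr (x : E) i‖ ^ 2 := by
      rw [← b.repr.norm_map, EuclideanSpace.norm_sq_eq]
    have hx := hU x x.2
    rw [hnorm, Finset.mul_sum, ← sub_nonpos, ← Finset.sum_sub_distrib] at hx
    have hnn : ∀ i ∈ Finset.univ,
        0 ≤ l i * ‖b.repr (x : E) i‖ ^ 2 - t * ‖b.repr (x : E) i‖ ^ 2 := by
      intro i _
      by_cases hi : l i ≤ t
      · simp [h0 i hi]
      · rw [← sub_mul]
        exact mul_nonneg (by linarith) (sq_nonneg _)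
    have hz := (Finset.sum_eq_zero_iff_of_nonneg hnn).1
      (le_antisymm hx (Finset.sum_nonneg hnn))
    have hrepr : b.repr (x : E) = 0 := by
      ext i
      by_cases hi : l i ≤ t
      · exact h0 i hi
      · have := hz i (Finset.mem_univ i)
        rw [← sub_mul, mul_eq_zero] at this
        rcases this with h | h
        · exact absurd h (by linarith)
        · simpa using h
    exact Subtype.ext (by simpa using hrepr)
  have := LinearMap.finrank_le_finrank_of_injective hg
  rwa [Module.finrank_fintype_fun_eq_card, Fintype.card_subtype] at this

/-- For every `t` there is a subspace, of dimension at least the number of diagonal entries that are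
at most `t`, on which the diagonal quadratic form is bounded above by `t‖x‖²`. -/
lemma exists_submodule_quadratic_le (b : OrthonormalBasis ι ℂ E) (l : ι → ℝ) (t : ℝ) :
    ∃ U : Submodule ℂ E, (Finset.univ.filter fun i => l i ≤ t).card ≤ Module.finrank ℂ U ∧
      ∀ x ∈ U, ∑ i, l i * ‖b.repr x i‖ ^ 2 ≤ t * ‖x‖ ^ 2 := by
  classical
  have : FiniteDimensional ℂ E := b.toBasis.finiteDimensional_of_finite
  let g : E →ₗ[ℂ] ({i // ¬ l i ≤ t} → ℂ) :=
    { toFun := fun x i => b.repr x i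
      map_add' := fun x y => by ext i; simp
      map_smul' := fun c x => by ext i; simp }
  refine ⟨LinearMap.ker g, ?_, fun x hx => ?_⟩
  · have h1 := g.finrank_range_add_finrank_ker
    have h2 := (LinearMap.range g).finrank_le
    rw [Module.finrank_fintype_fun_eq_card, Fintype.card_subtype] at h2
    rw [Module.finrank_eq_card_basis b.toBasis] at h1
    have h3 := Finset.card_filter_add_card_filter_not (s := Finset.univ) (fun i => l i ≤ t)
    rw [Finset.card_univ] at h3
    omega
  · rw [← b.repr.norm_map, EuclideanSpace.norm_sq_eq, Finset.mul_sum]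
    refine Finset.sum_le_sum fun i _ => ?_
    by_cases hi : l i ≤ t
    · gcongr
    · have : b.repr x i = 0 := congrFun (LinearMap.mem_ker.1 hx) ⟨i, hi⟩
      simp [this]

/-- Weyl's perturbation inequality, in terms of eigenvalue counts. -/
lemma card_le_card_of_quadratic_le_add {κ : Type*} [Fintype κ] (b : OrthonormalBasis ι ℂ E)
    (c : OrthonormalBasis κ ℂ E) (l : ι → ℝ) (k : κ → ℝ) (t ε : ℝ)
    (h : ∀ x, ∑ i, k i * ‖c.repr x i‖ ^ 2 ≤ ∑ i, l i * ‖b.repr x i‖ ^ 2 + ε * ‖x‖ ^ 2) :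
    (Finset.univ.filter fun i => l i ≤ t).card ≤
      (Finset.univ.filter fun i => k i ≤ t + ε).card := by
  obtain ⟨U, hcard, hU⟩ := exists_submodule_quadratic_le b l t
  refine hcard.trans (finrank_le_card_of_quadratic_le c k _ U fun x hx => (h x).trans ?_)
  linarith [hU x hx]

lemma re_inner_eq_sum_of_apply_eq_smul (b : OrthonormalBasis ι ℂ E) (l : ι → ℝ) (T : E →ₗ[ℂ] E)
    (hT : ∀ i, T (b i) = (l i : ℂ) • b i) (x : E) :
    (inner ℂ x (T x)).re = ∑ i, l i * ‖b.repr x i‖ ^ 2 := by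
  have hTx : T x = ∑ i, (b.repr x i * l i) • b i := by
    conv_lhs => rw [← b.sum_repr x]
    simp [hT, mul_smul]
  rw [hTx, inner_sum, Complex.re_sum]
  refine Finset.sum_congr rfl fun i _ => ?_
  rw [inner_smul_right, ← inner_conj_symm, ← b.repr_apply_apply, mul_right_comm, Complex.mul_conj,
    Complex.normSq_eq_norm_sq, ← Complex.ofReal_mul, Complex.ofReal_re, mul_comm]

end OrthonormalBasis

section Growth

variable {V : Type*} [NormedAddCommGroup V] [NormedSpace ℂ V] [FiniteDimensional ℂ V]

lemma exists_norm_pow_apply_le (f : V →L[ℂ] V) {R : ENNReal} (hf : spectralRadius ℂ f < R) :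
    ∃ r : NNReal, 0 < r ∧ (r : ENNReal) < R ∧
      ∀ᶠ n : ℕ in atTop, ∀ x, ‖(f ^ n) x‖ ≤ r ^ n * ‖x‖ := by
  have : CompleteSpace V := FiniteDimensional.complete ℂ V
  obtain ⟨r, hr, hrR⟩ := ENNReal.lt_iff_exists_nnreal_btwn.1 hf
  have hr0 : 0 < r := by exact_mod_cast (zero_le (a := spectralRadius ℂ f)).trans_lt hr
  refine ⟨r, hr0, hrR, ?_⟩
  filter_upwards [(spectrum.pow_nnnorm_pow_one_div_tendsto_nhds_spectralRadius f).eventually_lt_const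
    hr, eventually_gt_atTop 0] with n hn hn0 x
  refine (ContinuousLinearMap.le_opNorm _ _).trans ?_
  gcongr
  have h1 : (‖f ^ n‖₊ : ENNReal) ≤ (r : ENNReal) ^ n := by
    rw [one_div, ENNReal.rpow_inv_lt_iff (by positivity), ENNReal.rpow_natCast] at hn
    exact hn.le
  exact_mod_cast h1

lemma spectralRadius_toContinuousLinearMap_lt (f : Module.End ℂ V) {t : ℝ} (ht : 0 < t)
    (hf : ∀ ν, f.HasEigenvalue ν → ‖ν‖ < t) :
    spectralRadius ℂ (Module.End.toContinuousLinearMap V f) < ENNReal.ofReal t := by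
  have : CompleteSpace V := FiniteDimensional.complete ℂ V
  rcases subsingleton_or_nontrivial V with hV | hV
  · rw [Subsingleton.elim (Module.End.toContinuousLinearMap V f) 0]
    simpa using ht
  · refine spectrum.spectralRadius_lt_of_forall_lt _ fun ν hν => ?_
    rw [AlgEquiv.spectrum_eq, ← Module.End.hasEigenvalue_iff_mem_spectrum] at hν
    rw [← NNReal.coe_lt_coe, coe_nnnorm, Real.coe_toNNReal _ ht.le]
    exact hf ν hν

lemma exists_norm_pow_apply_le_of_eigenvalues_lt (f : Module.End ℂ V) {t : ℝ} (ht : 0 < t)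
    (hf : ∀ ν, f.HasEigenvalue ν → ‖ν‖ < t) :
    ∃ r, 0 < r ∧ r < t ∧ ∀ᶠ n : ℕ in atTop, ∀ x, ‖(f ^ n) x‖ ≤ r ^ n * ‖x‖ := by
  obtain ⟨r, hr0, hrt, h⟩ :=
    exists_norm_pow_apply_le _ (spectralRadius_toContinuousLinearMap_lt f ht hf)
  refine ⟨r, hr0, ?_, h.mono fun n hn x => ?_⟩
  · rwa [← ENNReal.ofReal_coe_nnreal, ENNReal.ofReal_lt_ofReal_iff ht] at hrt
  · have := hn x
    rwa [← map_pow] at this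

lemma exists_le_norm_pow_apply_of_lt_eigenvalues (f : Module.End ℂ V) {t : ℝ} (ht : 0 ≤ t)
    (hf : ∀ ν, f.HasEigenvalue ν → t < ‖ν‖) :
    ∃ r, t < r ∧ ∀ᶠ n : ℕ in atTop, ∀ x, r ^ n * ‖x‖ ≤ ‖(f ^ n) x‖ := by
  have : CompleteSpace V := FiniteDimensional.complete ℂ V
  have h0 : IsUnit f := by
    rw [← spectrum.zero_notMem_iff ℂ, ← Module.End.hasEigenvalue_iff_mem_spectrum]
    intro h
    simpa [ht.not_gt] using hf 0 h
  obtain ⟨u, rfl⟩ := h0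
  have hs : spectralRadius ℂ (Module.End.toContinuousLinearMap V (↑u⁻¹ : Module.End ℂ V)) <
      (ENNReal.ofReal t)⁻¹ := by
    rcases ht.eq_or_lt with rfl | ht
    · rcases subsingleton_or_nontrivial V with hV | hV
      · rw [Subsingleton.elim (Module.End.toContinuousLinearMap V _) 0]
        simp
      · simpa using (spectrum.spectralRadius_le_nnnorm _).trans_lt ENNReal.coe_lt_top
    · rw [← ENNReal.ofReal_inv_of_pos ht]
      refine spectralRadius_toContinuousLinearMap_lt _ (inv_pos.2 ht) fun ν hν => ?_
      rw [Module.End.hasEigenvalue_iff_mem_spectrum, ← spectrum.map_inv, Set.mem_inv,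
        ← Module.End.hasEigenvalue_iff_mem_spectrum] at hν
      have := hf _ hν
      rw [norm_inv] at this
      exact lt_inv_of_lt_inv₀ ht this
  obtain ⟨r, hr0, hrt, h⟩ := exists_norm_pow_apply_le _ hs
  refine ⟨(r : ℝ)⁻¹, ?_, h.mono fun n hn x => ?_⟩
  · have h1 := ENNReal.lt_inv_iff_lt_inv.1 hrt
    rw [← ENNReal.coe_inv hr0.ne', ← ENNReal.ofReal_coe_nnreal,
      ENNReal.ofReal_lt_ofReal_iff (by positivity)] at h1
    exact_mod_cast h1
  · have h2 := hn (((u : Module.End ℂ V) ^ n) x)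
    rw [← map_pow] at h2
    have h3 : ((↑u⁻¹ : Module.End ℂ V) ^ n) (((u : Module.End ℂ V) ^ n) x) = x := by
      rw [← Module.End.mul_apply, ← Units.val_pow_eq_pow_val, ← Units.val_pow_eq_pow_val,
        ← Units.val_mul, inv_pow, inv_mul_cancel]
      rfl
    have h4 : ‖((↑u⁻¹ : Module.End ℂ V) ^ n) (((u : Module.End ℂ V) ^ n) x)‖ ≤
      (r : ℝ) ^ n * ‖((u : Module.End ℂ V) ^ n) x‖ := h2
    rw [h3] at h4
    rwa [inv_pow, inv_mul_le_iff₀ (by positivity)]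

end Growth

section GenEigenspace

variable {V : Type*} [AddCommGroup V] [Module ℂ V] [FiniteDimensional ℂ V]

lemma finrank_finset_sup_eq_sum {ι : Type*} (N : ι → Submodule ℂ V) (hN : iSupIndep N)
    (S : Finset ι) : Module.finrank ℂ ↥(S.sup N) = ∑ i ∈ S, Module.finrank ℂ (N i) := by
  classical
  induction S using Finset.induction_on with
  | empty => simp
  | insert a S ha ih =>
    have hd : Disjoint (N a) (S.sup N) := by
      simpa [Finset.sup_eq_iSup] using hN.disjoint_biSup (y := (S : Set ι)) (by simpa using ha)
    have h := Submodule.finrank_sup_add_finrank_inf_eq (N a) (S.sup N)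
    rw [hd.eq_bot, finrank_bot, add_zero] at h
    rw [Finset.sup_insert, Finset.sum_insert ha, h, ih]

/-- There is an invariant subspace on which all eigenvalues satisfy `P` and whose dimension is at
least the number of eigenvalues, with multiplicity, satisfying `P`. -/
lemma exists_invariant_submodule_of_charpoly_eq {ι : Type*} [Fintype ι] (f : Module.End ℂ V)
    (μ : ι → ℂ) (hμ : f.charpoly = ∏ i, (X - C (μ i))) (P : ℂ → Prop) [DecidablePred P] :
    ∃ (U : Submodule ℂ V) (hU : ∀ x ∈ U, f x ∈ U),
      (Finset.univ.filter fun i => P (μ i)).card ≤ Module.finrank ℂ U ∧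
      ∀ ν, Module.End.HasEigenvalue (f.restrict hU) ν → P ν := by
  classical
  let S : Finset ℂ := (Finset.univ.image μ).filter P
  have hind := Module.End.independent_maxGenEigenspace f
  have hU : ∀ x ∈ S.sup f.maxGenEigenspace, f x ∈ S.sup f.maxGenEigenspace := by
    intro x hx
    rw [Finset.sup_eq_iSup] at hx ⊢
    have : ∀ ν ∈ S, f.maxGenEigenspace ν ≤
        (⨆ a ∈ S, f.maxGenEigenspace a).comap f := fun ν hν y hy =>
      (le_iSup₂_of_le (f := fun a _ => f.maxGenEigenspace a) ν hν le_rfl :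
        f.maxGenEigenspace ν ≤ ⨆ a ∈ S, f.maxGenEigenspace a)
        (f.mapsTo_maxGenEigenspace_of_comm (Commute.refl f) ν hy)
    exact iSup₂_le this hx
  refine ⟨S.sup f.maxGenEigenspace, hU, ?_, fun ν hν => ?_⟩
  · rw [finrank_finset_sup_eq_sum _ hind, Finset.card_eq_sum_card_fiberwise (f := μ) (t := S)
      (fun i hi => by simpa [S] using hi)]
    refine Finset.sum_le_sum fun ν _ => ?_
    rw [LinearMap.finrank_maxGenEigenspace_eq, hμ, ← Polynomial.count_roots,
      Polynomial.roots_prod _ _ (Finset.prod_ne_zero_iff.2 fun i _ => X_sub_C_ne_zero _)]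
    simp only [roots_X_sub_C, Multiset.bind_singleton, Multiset.count_map]
    change _ ≤ (Finset.univ.filter fun i => ν = μ i).card
    refine Finset.card_le_card fun i hi => ?_
    simpa using (Finset.mem_filter.1 hi).2.symm
  · by_contra hP
    obtain ⟨x, hx⟩ := hν.exists_hasEigenvector
    have hfx : f (x : V) = ν • (x : V) := congrArg Subtype.val hx.apply_eq_smul
    have hmem : (x : V) ∈ f.maxGenEigenspace ν :=
      Module.End.eigenspace_le_maxGenEigenspace (Module.End.mem_eigenspace_iff.2 hfx)
    have hd : Disjoint (f.maxGenEigenspace ν) (S.sup f.maxGenEigenspace) := by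
      simpa [Finset.sup_eq_iSup] using hind.disjoint_biSup (y := (S : Set ℂ)) (x := ν)
        (by simp [S, hP])
    exact hx.2 (Subtype.ext (Submodule.disjoint_def.1 hd _ hmem x.2))

end GenEigenspace

section Matrix

variable {m : ℕ}

lemma Matrix.IsHermitian.cfc_mulVec_eigenvectorBasis {M : Matrix (Fin m) (Fin m) ℂ}
    (hM : M.IsHermitian) (f : ℝ → ℝ) (i : Fin m) :
    Matrix.toEuclideanLin (cfc f M) (hM.eigenvectorBasis i) =
      ((f (hM.eigenvalues i) : ℝ) : ℂ) • hM.eigenvectorBasis i := by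
  have h : cfc f M *ᵥ ⇑(hM.eigenvectorBasis i) =
      ((f (hM.eigenvalues i) : ℝ) : ℂ) • ⇑(hM.eigenvectorBasis i) := by
    rw [hM.cfc_eq, Matrix.IsHermitian.cfc, Unitary.conjStarAlgAut_apply, ← mulVec_mulVec,
      ← mulVec_mulVec, hM.star_eigenvectorUnitary_mulVec]
    have h1 : (Pi.single i ((RCLike.ofReal ∘ f ∘ hM.eigenvalues) i) : Fin m → ℂ) =
        ((f (hM.eigenvalues i) : ℝ) : ℂ) • Pi.single i 1 := by
      rw [← Pi.single_smul, smul_eq_mul, mul_one]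
      rfl
    rw [diagonal_mulVec_single, mul_one, h1, mulVec_smul, hM.eigenvectorUnitary_mulVec]
  ext j
  exact congrFun h j

lemma Matrix.IsHermitian.toEuclideanLin_eigenvectorBasis {M : Matrix (Fin m) (Fin m) ℂ}
    (hM : M.IsHermitian) (i : Fin m) :
    Matrix.toEuclideanLin M (hM.eigenvectorBasis i) =
      (hM.eigenvalues i : ℂ) • hM.eigenvectorBasis i := by
  ext j
  have := congrFun (hM.mulVec_eigenvectorBasis i) j
  simpa using this

lemma re_inner_toEuclideanLin_conjTranspose_mul_self (B : Matrix (Fin m) (Fin m) ℂ)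
    (x : EuclideanSpace ℂ (Fin m)) :
    (inner ℂ x (Matrix.toEuclideanLin (Bᴴ * B) x)).re = ‖Matrix.toEuclideanLin B x‖ ^ 2 := by
  have : Matrix.toEuclideanLin (Bᴴ * B) x =
      LinearMap.adjoint (Matrix.toEuclideanLin B) (Matrix.toEuclideanLin B x) := by
    rw [← Matrix.toEuclideanLin_conjTranspose_eq_adjoint]
    ext j
    simp [Matrix.mulVec_mulVec]
  rw [this, LinearMap.adjoint_inner_right, inner_self_eq_norm_sq_to_K]
  norm_cast

lemma toEuclideanLin_pow (A : Matrix (Fin m) (Fin m) ℂ) (n : ℕ) :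
    Matrix.toEuclideanLin (A ^ n) = Matrix.toEuclideanLin A ^ n := by
  induction n with
  | zero => ext x; simp
  | succ n ih =>
    rw [pow_succ, pow_succ, ← ih]
    ext x
    simp

lemma charpoly_toEuclideanLin (A : Matrix (Fin m) (Fin m) ℂ) :
    (Matrix.toEuclideanLin A).charpoly = A.charpoly := by
  rw [Matrix.toEuclideanLin_eq_toLin_orthonormal, Matrix.charpoly_toLin]

/-- Convergent matrices have uniformly convergent quadratic forms on the unit ball. -/
lemma eventually_abs_re_inner_sub_le {α : Type*} {F : Filter α}
    {G : α → Matrix (Fin m) (Fin m) ℂ} {H : Matrix (Fin m) (Fin m) ℂ} (hG : Tendsto G F (nhds H))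
    {ε : ℝ} (hε : 0 < ε) :
    ∀ᶠ j in F, ∀ x : EuclideanSpace ℂ (Fin m),
      |(inner ℂ x (Matrix.toEuclideanLin (G j) x)).re -
        (inner ℂ x (Matrix.toEuclideanLin H x)).re| ≤ ε * ‖x‖ ^ 2 := by
  let L : Matrix (Fin m) (Fin m) ℂ →ₗ[ℂ]
      (EuclideanSpace ℂ (Fin m) →L[ℂ] EuclideanSpace ℂ (Fin m)) :=
    (Matrix.toEuclideanLin ≪≫ₗ LinearMap.toContinuousLinearMap).toLinearMap
  have hL : Continuous L := L.continuous_of_finiteDimensional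
  have ht : Tendsto (fun j => ‖L (G j) - L H‖) F (nhds 0) :=
    tendsto_iff_norm_sub_tendsto_zero.1 ((hL.tendsto H).comp hG)
  filter_upwards [ht.eventually_le_const hε] with j hj x
  have h1 : (inner ℂ x (Matrix.toEuclideanLin (G j) x)).re -
      (inner ℂ x (Matrix.toEuclideanLin H x)).re = (inner ℂ x ((L (G j) - L H) x)).re := by
    rw [← Complex.sub_re, ← inner_sub_right]
    rfl
  rw [h1]
  calc |(inner ℂ x ((L (G j) - L H) x)).re| ≤ ‖inner ℂ x ((L (G j) - L H) x)‖ :=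
        Complex.abs_re_le_norm _
    _ ≤ ‖x‖ * ‖(L (G j) - L H) x‖ := norm_inner_le_norm _ _
    _ ≤ ‖x‖ * (ε * ‖x‖) := by
        gcongr
        exact ((L (G j) - L H).le_opNorm x).trans (by gcongr)
    _ = ε * ‖x‖ ^ 2 := by ring

end Matrix

/-- Finite families of real numbers agree as multisets when the counting functions of their
upper and lower level sets compare. -/
lemma multiset_map_eq_of_card_le {ι : Type*} [Fintype ι] (h k : ι → ℝ)
    (hle : ∀ t, (Finset.univ.filter fun i => h i ≤ t).card ≤
      (Finset.univ.filter fun i => k i ≤ t).card)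
    (hge : ∀ t, (Finset.univ.filter fun i => t ≤ h i).card ≤
      (Finset.univ.filter fun i => t ≤ k i).card) :
    Multiset.map h Finset.univ.val = Multiset.map k Finset.univ.val := by
  classical
  have key : ∀ (g : ι → ℝ) t, (Finset.univ.filter fun i => g i ≤ t).card +
      (Finset.univ.filter fun i => t ≤ g i).card =
        Fintype.card ι + (Multiset.map g Finset.univ.val).count t := by
    intro g t
    rw [← Finset.card_union_add_card_inter, ← Finset.filter_or, ← Finset.filter_and,
      Multiset.count_map]
    congr 1
    · rw [Finset.filter_true_of_mem fun i _ => le_total _ _, Finset.card_univ]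
    · exact congrArg Finset.card (Finset.filter_congr fun i _ => by
        rw [← le_antisymm_iff, eq_comm])
  refine Multiset.eq_of_le_of_card_le (Multiset.le_iff_count.2 fun t => ?_) (by simp)
  have h1 := key h t
  have h2 := key k t
  have h3 := hle t
  have h4 := hge t
  omega

section LimitPoint

variable {m : ℕ} {A H : Matrix (Fin m) (Fin m) ℂ} {μ : Fin m → ℂ} {φ : ℕ → ℕ}

lemma isHermitian_of_tendsto_absPow (hH : Tendsto
    (fun j => absPow (A ^ φ j) (1 / (φ j : ℝ))) atTop (nhds H)) : H.IsHermitian := by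
  have hc : IsClosed {M : Matrix (Fin m) (Fin m) ℂ | Mᴴ = M} :=
    isClosed_eq continuous_id.matrix_conjTranspose continuous_id
  exact hc.mem_of_tendsto hH (Eventually.of_forall fun j =>
    (IsSelfAdjoint.cfc : IsSelfAdjoint (absPow (A ^ φ j) (1 / (φ j : ℝ)))))

lemma re_inner_absPow_eq_sum (B : Matrix (Fin m) (Fin m) ℂ) (p : ℝ)
    (x : EuclideanSpace ℂ (Fin m)) :
    (inner ℂ x (Matrix.toEuclideanLin (absPow B p) x)).re =
      ∑ i, (isHermitian_conjTranspose_mul_self B).eigenvalues i ^ (p / 2) *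
        ‖(isHermitian_conjTranspose_mul_self B).eigenvectorBasis.repr x i‖ ^ 2 :=
  re_inner_eq_sum_of_apply_eq_smul _ _ _
    ((isHermitian_conjTranspose_mul_self B).cfc_mulVec_eigenvectorBasis _) x

lemma norm_sq_apply_eq_sum (B : Matrix (Fin m) (Fin m) ℂ) (x : EuclideanSpace ℂ (Fin m)) :
    ‖Matrix.toEuclideanLin B x‖ ^ 2 =
      ∑ i, (isHermitian_conjTranspose_mul_self B).eigenvalues i *
        ‖(isHermitian_conjTranspose_mul_self B).eigenvectorBasis.repr x i‖ ^ 2 := by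
  rw [← re_inner_toEuclideanLin_conjTranspose_mul_self]
  exact re_inner_eq_sum_of_apply_eq_smul _ _ _
    (isHermitian_conjTranspose_mul_self B).toEuclideanLin_eigenvectorBasis x

lemma rpow_pow_two_mul {n : ℕ} (hn : n ≠ 0) {r : ℝ} (hr : 0 ≤ r) :
    ((r ^ n) ^ 2) ^ (1 / (n : ℝ) / 2) = r := by
  rw [← pow_mul, ← Real.rpow_natCast, ← Real.rpow_mul hr]
  have : (n : ℝ) ≠ 0 := by exact_mod_cast hn
  rw [show ((n * 2 : ℕ) : ℝ) * (1 / (n : ℝ) / 2) = 1 by push_cast; field_simp, Real.rpow_one]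

lemma card_add_card_le_of_disjoint {p q : Fin m → Prop} [DecidablePred p] [DecidablePred q]
    (h : ∀ i, p i → ¬ q i) :
    (Finset.univ.filter p).card + (Finset.univ.filter q).card ≤ m := by
  rw [← Finset.card_union_of_disjoint (Finset.disjoint_filter.2 fun i _ => h i)]
  exact (Finset.card_le_univ _).trans_eq (Fintype.card_fin m)

lemma restrict_pow_apply_coe {U : Submodule ℂ (EuclideanSpace ℂ (Fin m))}
    (hU : ∀ x ∈ U, Matrix.toEuclideanLin A x ∈ U) (n : ℕ) (x : U) :
    ((((Matrix.toEuclideanLin A).restrict hU : Module.End ℂ U) ^ n) x :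
      EuclideanSpace ℂ (Fin m)) = Matrix.toEuclideanLin (A ^ n) x := by
  rw [toEuclideanLin_pow, Module.End.pow_restrict n]
  rfl

lemma card_eigenvalues_le_le
    (hμ : A.charpoly = ∏ i, (X - C (μ i))) (hφ : StrictMono φ)
    (hH : Tendsto (fun j => absPow (A ^ φ j) (1 / (φ j : ℝ))) atTop (nhds H))
    (hHh : H.IsHermitian) (t : ℝ) :
    (Finset.univ.filter fun i => hHh.eigenvalues i ≤ t).card ≤
      (Finset.univ.filter fun i => ‖μ i‖ ≤ t).card := by
  have weyl : ∀ ε > 0, ∀ᶠ j in atTop, (Finset.univ.filter fun i => hHh.eigenvalues i ≤ t).card ≤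
      (Finset.univ.filter fun i => (isHermitian_conjTranspose_mul_self (A ^ φ j)).eigenvalues i ^
        (1 / (φ j : ℝ) / 2) ≤ t + ε).card := by
    intro ε hε
    filter_upwards [eventually_abs_re_inner_sub_le hH hε] with j hj
    refine card_le_card_of_quadratic_le_add hHh.eigenvectorBasis
      (isHermitian_conjTranspose_mul_self (A ^ φ j)).eigenvectorBasis _ _ t ε fun x => ?_
    have h1 := (abs_le.1 (hj x)).2
    rw [re_inner_absPow_eq_sum, re_inner_eq_sum_of_apply_eq_smul _ _ _
      hHh.toEuclideanLin_eigenvectorBasis] at h1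
    linarith
  rcases lt_or_ge t 0 with ht | ht
  · obtain ⟨j, hj⟩ := (weyl (-t / 2) (by linarith)).exists
    refine hj.trans ?_
    rw [Finset.filter_false_of_mem, Finset.card_empty]
    · exact Nat.zero_le _
    · intro i _
      have := Real.rpow_nonneg (eigenvalues_conjTranspose_mul_self_nonneg (A ^ φ j) i)
        (1 / (φ j : ℝ) / 2)
      linarith
  · obtain ⟨U, hU, hcard, heig⟩ := exists_invariant_submodule_of_charpoly_eq
      (Matrix.toEuclideanLin A) μ ((charpoly_toEuclideanLin A).trans hμ) (fun z => t < ‖z‖)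
    obtain ⟨r, htr, hr⟩ := exists_le_norm_pow_apply_of_lt_eigenvalues _ ht heig
    obtain ⟨j, hj, hrj, hj0⟩ := ((weyl ((r - t) / 2) (by linarith)).and
      ((hφ.tendsto_atTop.eventually hr).and (hφ.tendsto_atTop.eventually_gt_atTop 0))).exists
    have hr0 : 0 ≤ r := ht.trans htr.le
    have h2 := finrank_le_card_of_quadratic_le
      (isHermitian_conjTranspose_mul_self (A ^ φ j)).eigenvectorBasis
      (fun i => -(isHermitian_conjTranspose_mul_self (A ^ φ j)).eigenvalues i)
      (-(r ^ φ j) ^ 2) U fun x hx => by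
        have h3 := hrj ⟨x, hx⟩
        rw [Submodule.coe_norm, Submodule.coe_norm, restrict_pow_apply_coe] at h3
        have h4 := pow_le_pow_left₀ (by positivity) h3 2
        rw [norm_sq_apply_eq_sum, mul_pow] at h4
        simp only [neg_mul, Finset.sum_neg_distrib]
        exact neg_le_neg h4
    have h5 : _ + _ ≤ m := card_add_card_le_of_disjoint
      (p := fun i => (isHermitian_conjTranspose_mul_self (A ^ φ j)).eigenvalues i ^
        (1 / (φ j : ℝ) / 2) ≤ t + (r - t) / 2)
      (q := fun i => -(isHermitian_conjTranspose_mul_self (A ^ φ j)).eigenvalues i ≤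
        -(r ^ φ j) ^ 2) fun i hp hq => by
          have h6 := Real.rpow_le_rpow (z := 1 / (φ j : ℝ) / 2) (by positivity) (neg_le_neg_iff.1 hq)
            (by positivity)
          rw [rpow_pow_two_mul hj0.ne' hr0] at h6
          linarith
    have h7 := Finset.card_filter_add_card_filter_not (s := Finset.univ) (fun i => ‖μ i‖ ≤ t)
    simp only [not_le, Finset.card_univ, Fintype.card_fin] at h7
    omega

lemma card_le_eigenvalues_le
    (hμ : A.charpoly = ∏ i, (X - C (μ i))) (hφ : StrictMono φ)
    (hH : Tendsto (fun j => absPow (A ^ φ j) (1 / (φ j : ℝ))) atTop (nhds H))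
    (hHh : H.IsHermitian) (t : ℝ) :
    (Finset.univ.filter fun i => t ≤ hHh.eigenvalues i).card ≤
      (Finset.univ.filter fun i => t ≤ ‖μ i‖).card := by
  rcases le_or_gt t 0 with ht | ht
  · rw [Finset.filter_true_of_mem (p := fun i => t ≤ ‖μ i‖)
      fun i _ => ht.trans (norm_nonneg _)]
    exact Finset.card_le_univ _
  obtain ⟨U, hU, hcard, heig⟩ := exists_invariant_submodule_of_charpoly_eq
    (Matrix.toEuclideanLin A) μ ((charpoly_toEuclideanLin A).trans hμ) (fun z => ‖z‖ < t)
  obtain ⟨r, hr0, hrt, hr⟩ := exists_norm_pow_apply_le_of_eigenvalues_lt _ ht heig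
  have hε : 0 < (t - r) / 2 := by linarith
  obtain ⟨j, hj, hrj, hj0⟩ := ((eventually_abs_re_inner_sub_le hH hε).and
    ((hφ.tendsto_atTop.eventually hr).and (hφ.tendsto_atTop.eventually_gt_atTop 0))).exists
  have h1 := card_le_card_of_quadratic_le_add hHh.eigenvectorBasis
    (isHermitian_conjTranspose_mul_self (A ^ φ j)).eigenvectorBasis
    (fun i => -hHh.eigenvalues i)
    (fun i => -(isHermitian_conjTranspose_mul_self (A ^ φ j)).eigenvalues i ^
      (1 / (φ j : ℝ) / 2)) (-t) ((t - r) / 2) fun x => by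
        have h1 := (abs_le.1 (hj x)).1
        rw [re_inner_absPow_eq_sum, re_inner_eq_sum_of_apply_eq_smul _ _ _
          hHh.toEuclideanLin_eigenvectorBasis] at h1
        simp only [neg_mul, Finset.sum_neg_distrib]
        linarith
  simp only [neg_le_neg_iff] at h1
  have h2 := finrank_le_card_of_quadratic_le
    (isHermitian_conjTranspose_mul_self (A ^ φ j)).eigenvectorBasis
    (isHermitian_conjTranspose_mul_self (A ^ φ j)).eigenvalues
    ((r ^ φ j) ^ 2) U fun x hx => by
      have h3 := hrj ⟨x, hx⟩
      rw [Submodule.coe_norm, Submodule.coe_norm, restrict_pow_apply_coe] at h3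
      have h4 := pow_le_pow_left₀ (by positivity) h3 2
      rwa [norm_sq_apply_eq_sum, mul_pow] at h4
  have h5 : _ + _ ≤ m := card_add_card_le_of_disjoint
    (p := fun i => -(isHermitian_conjTranspose_mul_self (A ^ φ j)).eigenvalues i ^
      (1 / (φ j : ℝ) / 2) ≤ -t + (t - r) / 2)
    (q := fun i => (isHermitian_conjTranspose_mul_self (A ^ φ j)).eigenvalues i ≤
      (r ^ φ j) ^ 2) fun i hp hq => by
        have h6 := Real.rpow_le_rpow (z := 1 / (φ j : ℝ) / 2)
          (eigenvalues_conjTranspose_mul_self_nonneg (A ^ φ j) i) hq (by positivity)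
        rw [rpow_pow_two_mul hj0.ne' hr0.le] at h6
        linarith
  have h7 := Finset.card_filter_add_card_filter_not (s := Finset.univ) (fun i => t ≤ ‖μ i‖)
  simp only [not_le, Finset.card_univ, Fintype.card_fin] at h7
  omega

end LimitPoint

/-- Let A ∈ M_m(ℂ) and let H be a limit point of the sequence {|A^n|^{1/n}}. Then the
multiset of eigenvalues of H (with multiplicity, i.e. the roots of its characteristic
polynomial) equals the multiset of moduli of the eigenvalues of A (with multiplicity). -/
theorem charpoly_roots_limit_point_eq_abs_eigenvalues (m : ℕ)
    (A : Matrix (Fin m) (Fin m) ℂ) (μ : Fin m → ℂ)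
    (hμ : A.charpoly = ∏ i, (X - C (μ i)))
    (H : Matrix (Fin m) (Fin m) ℂ) (φ : ℕ → ℕ) (hφ : StrictMono φ)
    (hH : Tendsto (fun j => absPow (A ^ φ j) (1 / (φ j : ℝ))) atTop (nhds H)) :
    H.charpoly.roots = Multiset.map (fun i => (‖μ i‖ : ℂ)) Finset.univ.val := by
  have hHh := isHermitian_of_tendsto_absPow hH
  rw [hHh.roots_charpoly_eq_eigenvalues]
  have h := multiset_map_eq_of_card_le hHh.eigenvalues (fun i => ‖μ i‖)
    (card_eigenvalues_le_le hμ hφ hH hHh) (card_le_eigenvalues_le hμ hφ hH hHh)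
  have h' := congrArg (Multiset.map fun x : ℝ => (x : ℂ)) h
  rw [Multiset.map_map, Multiset.map_map] at h'
  exact h'
end

section
/- Let A ∈ M_m(ℂ) with Jordan-Chevalley decomposition A = D + N (D diagonalizable, N nilpotent, DN = ND), and let H be a limit point of the sequence {|A^n|^{1/n}}_{n ∈ ℕ}. Then for every r ≥ 0, V(A, r) = V(H, r), and both are equal to the linear span of the set of eigenvectors of D whose eigenvalues have modulus at most r. Here V(T, r) := { x ∈ ℂ^m : limsup_n ‖T^n x‖^{1/n} ≤ r }. -/
open Filter Matrix Polynomial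

/-- A log-convex sequence of nonnegative reals satisfies `a k ^ n ≤ a n ^ k * a 0 ^ (n - k)`. -/
theorem pow_le_pow_mul_pow_of_logConvex {a : ℕ → ℝ} (ha : ∀ k, 0 ≤ a k)
    (hlog : ∀ k, a (k + 1) ^ 2 ≤ a k * a (k + 2)) {k n : ℕ} (hkn : k ≤ n) :
    a k ^ n ≤ a n ^ k * a 0 ^ (n - k) := by
  have hstep : ∀ k, a k ^ (k + 1) ≤ a (k + 1) ^ k * a 0 := by
    intro k
    induction k with
    | zero => simp
    | succ k ih =>
      rcases (ha (k + 1)).eq_or_lt with h0 | hpos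
      · rw [← h0, zero_pow (by lia)]
        exact mul_nonneg (pow_nonneg (ha _) _) (ha 0)
      · refine le_of_mul_le_mul_left ?_ (pow_pos hpos k)
        calc a (k + 1) ^ k * a (k + 1) ^ (k + 1 + 1)
            = (a (k + 1) ^ 2) ^ (k + 1) := by ring
          _ ≤ (a k * a (k + 2)) ^ (k + 1) := pow_le_pow_left₀ (sq_nonneg _) (hlog k) _
          _ = a k ^ (k + 1) * a (k + 2) ^ (k + 1) := mul_pow _ _ _
          _ ≤ a (k + 1) ^ k * a 0 * a (k + 2) ^ (k + 1) :=
              mul_le_mul_of_nonneg_right ih (pow_nonneg (ha _) _)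
          _ = a (k + 1) ^ k * (a (k + 1 + 1) ^ (k + 1) * a 0) := by ring
  induction n, hkn using Nat.le_induction with
  | base => simp
  | succ n hkn ih =>
    rcases Nat.eq_zero_or_pos n with rfl | hn
    · obtain rfl : k = 0 := by lia
      simp
    · refine (pow_le_pow_iff_left₀ (pow_nonneg (ha _) _)
        (mul_nonneg (pow_nonneg (ha _) _) (pow_nonneg (ha _) _)) hn.ne').1 ?_
      obtain ⟨j, rfl⟩ := Nat.exists_eq_add_of_le hkn
      rw [Nat.add_sub_cancel_left] at ih
      rw [show k + j + 1 - k = j + 1 by lia]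
      calc (a k ^ (k + j + 1)) ^ (k + j) = (a k ^ (k + j)) ^ (k + j + 1) := by ring
        _ ≤ (a (k + j) ^ k * a 0 ^ j) ^ (k + j + 1) :=
            pow_le_pow_left₀ (pow_nonneg (ha _) _) ih _
        _ = (a (k + j) ^ (k + j + 1)) ^ k * a 0 ^ (j * (k + j + 1)) := by ring
        _ ≤ (a (k + j + 1) ^ (k + j) * a 0) ^ k * a 0 ^ (j * (k + j + 1)) :=
            mul_le_mul_of_nonneg_right
              (pow_le_pow_left₀ (pow_nonneg (ha _) _) (hstep _) _) (pow_nonneg (ha _) _)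
        _ = (a (k + j + 1) ^ k * a 0 ^ (j + 1)) ^ (k + j) := by ring

theorem IsSelfAdjoint.inner_pow_apply {E : Type*} [NormedAddCommGroup E] [InnerProductSpace ℂ E]
    [CompleteSpace E] {K : E →L[ℂ] E} (hK : IsSelfAdjoint K) (n : ℕ) (x y : E) :
    inner ℂ ((K ^ n) x) y = inner ℂ x ((K ^ n) y) := by
  rw [← ContinuousLinearMap.adjoint_inner_right, ← ContinuousLinearMap.star_eq_adjoint,
    (hK.pow n).star_eq]

/-- Interpolation inequality for the powers of a self-adjoint operator. -/
theorem IsSelfAdjoint.norm_pow_apply_pow_le {E : Type*} [NormedAddCommGroup E] [InnerProductSpace ℂ E]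
    [CompleteSpace E] {K : E →L[ℂ] E} (hK : IsSelfAdjoint K) (x : E)
    {k n : ℕ} (hkn : k ≤ n) :
    ‖(K ^ k) x‖ ^ n ≤ ‖(K ^ n) x‖ ^ k * ‖x‖ ^ (n - k) := by
  have h := pow_le_pow_mul_pow_of_logConvex (a := fun k => ‖(K ^ k) x‖)
    (fun k => norm_nonneg _) ?_ hkn
  · simpa using h
  · intro k
    have hin : inner ℂ ((K ^ (k + 1)) x) ((K ^ (k + 1)) x) =
        inner ℂ ((K ^ k) x) ((K ^ (k + 2)) x) := by
      have h1 := hK.inner_pow_apply 1 ((K ^ k) x) ((K ^ (k + 1)) x)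
      rwa [← mul_apply_eq_comp, ← mul_apply_eq_comp, ← pow_add,
        ← pow_add, add_comm 1 k, show 1 + (k + 1) = k + 2 by lia] at h1
    have h2 := norm_inner_le_norm (𝕜 := ℂ) ((K ^ k) x) ((K ^ (k + 2)) x)
    rw [← hin, inner_self_eq_norm_sq_to_K] at h2
    simpa using h2

/-- `limsup ‖T ^ n x‖ ^ (1 / n) ≤ r` means that the orbit of `x` grows at rate at most `r`. -/
theorem limsup_norm_pow_apply_rpow_le_iff {E : Type*} [NormedAddCommGroup E] [InnerProductSpace ℂ E]
    (T : E →L[ℂ] E) (x : E) {r : ℝ} (hr : 0 ≤ r) :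
    limsup (fun n : ℕ => ‖(T ^ n) x‖ ^ (1 / (n : ℝ))) atTop ≤ r ↔
      ∀ s > r, ∀ᶠ n : ℕ in atTop, ‖(T ^ n) x‖ ≤ s ^ n := by
  have hroot : ∀ {n : ℕ} {a b : ℝ}, 0 < n → 0 ≤ a → 0 ≤ b →
      (a ^ (1 / (n : ℝ)) ≤ b ↔ a ≤ b ^ n) := by
    intro n a b hn ha hb
    rw [one_div, Real.rpow_inv_le_iff_of_pos ha hb (by exact_mod_cast hn), Real.rpow_natCast]
  have hbdd : IsBoundedUnder (· ≤ ·) atTop fun n : ℕ => ‖(T ^ n) x‖ ^ (1 / (n : ℝ)) := by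
    refine isBoundedUnder_of_eventually_le (a := max 1 ‖x‖ * (max 1 ‖T‖)) ?_
    filter_upwards [eventually_gt_atTop 0] with n hn
    rw [hroot hn (norm_nonneg _) (by positivity), mul_pow]
    calc ‖(T ^ n) x‖ ≤ ‖T ^ n‖ * ‖x‖ := (T ^ n).le_opNorm x
      _ ≤ ‖T‖ ^ n * ‖x‖ := by gcongr; exact norm_pow_le' T hn
      _ = ‖x‖ * ‖T‖ ^ n := mul_comm _ _
      _ ≤ max 1 ‖x‖ ^ n * max 1 ‖T‖ ^ n := by
          gcongr
          · exact (le_max_right _ _).trans (le_self_pow₀ (le_max_left _ _) hn.ne')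
          · exact le_max_right _ _
  rw [limsup_le_iff' (isCoboundedUnder_le_of_le atTop (x := 0) fun n => by positivity) hbdd]
  refine forall₂_congr fun s hs => eventually_congr ?_
  filter_upwards [eventually_gt_atTop 0] with n hn
  exact hroot hn (norm_nonneg _) (hr.trans hs.le)

theorem eventually_mul_pow_le_pow {s t : ℝ} (c : ℝ) (hs : 0 ≤ s) (hst : s < t) :
    ∀ᶠ n : ℕ in atTop, c * s ^ n ≤ t ^ n := by
  have ht : 0 < t := hs.trans_lt hst
  have h : Tendsto (fun n : ℕ => c * (s / t) ^ n) atTop (nhds (c * 0)) :=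
    (tendsto_pow_atTop_nhds_zero_of_lt_one (by positivity) ((div_lt_one ht).2 hst)).const_mul c
  rw [mul_zero] at h
  filter_upwards [h.eventually (eventually_le_nhds zero_lt_one)] with n hn
  rwa [div_pow, ← mul_div_assoc, div_le_one (by positivity)] at hn

/-- By Gelfand's formula the powers of `a` grow no faster than those of any number exceeding
the moduli of the spectrum. -/
theorem eventually_norm_pow_le_of_spectrum {B : Type*} [NormedRing B] [NormedAlgebra ℂ B]
    [CompleteSpace B] (a : B) {r s : ℝ} (hr : 0 ≤ r) (hrs : r < s)
    (ha : ∀ z ∈ spectrum ℂ a, ‖z‖ ≤ r) : ∀ᶠ n : ℕ in atTop, ‖a ^ n‖ ≤ s ^ n := by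
  have hlt : spectralRadius ℂ a < ENNReal.ofReal s := by
    refine lt_of_le_of_lt (iSup₂_le fun z hz => ?_)
      ((ENNReal.ofReal_lt_ofReal_iff (hr.trans_lt hrs)).2 hrs)
    rw [← ENNReal.ofReal_coe_nnreal]
    exact ENNReal.ofReal_le_ofReal (by simpa using ha z hz)
  filter_upwards [(spectrum.pow_norm_pow_one_div_tendsto_nhds_spectralRadius a).eventually
    (eventually_lt_nhds hlt), eventually_gt_atTop 0] with n hn hn0
  have h := ((ENNReal.ofReal_lt_ofReal_iff (hr.trans_lt hrs)).1 hn).le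
  rwa [one_div, Real.rpow_inv_le_iff_of_pos (norm_nonneg _) (hr.trans hrs.le)
    (by exact_mod_cast hn0), Real.rpow_natCast] at h

/-- The spectrum is not enlarged by adding a commuting nilpotent element. -/
theorem spectrum_add_subset_of_isNilpotent {B : Type*} [Ring B] [Algebra ℂ B] {a b : B}
    (hb : IsNilpotent b) (hab : Commute a b) : spectrum ℂ (a + b) ⊆ spectrum ℂ a := by
  intro z hz hza
  refine hz ?_
  have h : IsUnit (algebraMap ℂ B z - a + -b) :=
    hb.neg.isUnit_add_left_of_commute hza
      (((Algebra.commute_algebraMap_right z b).sub_right hab.symm).neg_left)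
  change IsUnit _
  rwa [sub_add_eq_sub_sub, sub_eq_add_neg _ b]


/-- If `K ^ φ j` has the same norms as `A ^ φ j`, with `K j` self-adjoint and converging to `H`,
then orbits of `H` grow no faster than those of `A`. -/
theorem norm_limit_pow_apply_le {E : Type*} [NormedAddCommGroup E] [InnerProductSpace ℂ E]
    [CompleteSpace E] {A H : E →L[ℂ] E} {K : ℕ → E →L[ℂ] E} {φ : ℕ → ℕ}
    (hφ : Tendsto φ atTop atTop) (hK : ∀ j, IsSelfAdjoint (K j))
    (hKA : ∀ᶠ j in atTop, ∀ x, ‖(K j ^ φ j) x‖ = ‖(A ^ φ j) x‖)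
    (hH : Tendsto K atTop (nhds H)) {x : E} {s : ℝ} (hs : 0 ≤ s)
    (hx : ∀ᶠ n : ℕ in atTop, ‖(A ^ n) x‖ ≤ s ^ n) (k : ℕ) :
    ‖(H ^ k) x‖ ≤ max 1 ‖x‖ * s ^ k := by
  have hlim : Tendsto (fun j => ‖(K j ^ k) x‖) atTop (nhds ‖(H ^ k) x‖) :=
    ((ContinuousLinearMap.apply ℂ E x).continuous.tendsto _ |>.comp (hH.pow k)).norm
  refine le_of_tendsto hlim ?_
  filter_upwards [hKA, hφ.eventually hx, hφ.eventually (eventually_ge_atTop k),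
    hφ.eventually (eventually_gt_atTop 0)] with j hj hxj hkj h0
  refine (pow_le_pow_iff_left₀ (norm_nonneg _) (by positivity) h0.ne').1 ?_
  calc ‖(K j ^ k) x‖ ^ φ j ≤ ‖(K j ^ φ j) x‖ ^ k * ‖x‖ ^ (φ j - k) :=
        (hK j).norm_pow_apply_pow_le x hkj
    _ ≤ (s ^ φ j) ^ k * (max 1 ‖x‖) ^ φ j := by
        rw [hj]
        gcongr
        calc ‖x‖ ^ (φ j - k) ≤ (max 1 ‖x‖) ^ (φ j - k) := by
              gcongr
              exact le_max_right _ _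
          _ ≤ (max 1 ‖x‖) ^ φ j := pow_le_pow_right₀ (le_max_left _ _) (Nat.sub_le _ _)
    _ = (max 1 ‖x‖ * s ^ k) ^ φ j := by ring

theorem IsSelfAdjoint.norm_apply_eq_of_mul_self_eq {E : Type*} [NormedAddCommGroup E]
    [InnerProductSpace ℂ E] [CompleteSpace E] {S T : E →L[ℂ] E} (hS : IsSelfAdjoint S)
    (hST : S * S = star T * T) (u : E) : ‖S u‖ = ‖T u‖ := by
  have h := DFunLike.congr_fun hST u
  have h2 : inner ℂ (S u) (S u) = inner ℂ (T u) (T u) := by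
    rw [← ContinuousLinearMap.adjoint_inner_left S, ← ContinuousLinearMap.adjoint_inner_left T,
      ← ContinuousLinearMap.star_eq_adjoint, ← ContinuousLinearMap.star_eq_adjoint, hS.star_eq]
    exact congrArg (fun v => inner ℂ v u) h
  rw [inner_self_eq_norm_sq_to_K, inner_self_eq_norm_sq_to_K] at h2
  exact (pow_left_inj₀ (norm_nonneg _) (norm_nonneg _) two_ne_zero).1 (by exact_mod_cast h2)

/-- If `S` is self-adjoint with `S * S = T⋆ * T`, then `T⋆ z` is the image under `S` of a vector
no longer than `z`. -/
theorem exists_apply_eq_adjoint_apply {E : Type*} [NormedAddCommGroup E] [InnerProductSpace ℂ E]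
    [FiniteDimensional ℂ E] [CompleteSpace E] {S T : E →L[ℂ] E} (hS : IsSelfAdjoint S)
    (hST : S * S = star T * T) (z : E) : ∃ w, S w = star T z ∧ ‖w‖ ≤ ‖z‖ := by
  obtain ⟨u, hu⟩ := T.range.starProjection_apply_mem z
  have horth : z - T.range.starProjection z ∈ T.rangeᗮ :=
    Submodule.sub_starProjection_mem_orthogonal z
  rw [ContinuousLinearMap.orthogonal_range] at horth
  have hu' : T u = T.range.starProjection z := hu
  refine ⟨S u, ?_, ?_⟩
  · have h0 : star T (z - T.range.starProjection z) = 0 := horth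
    rw [map_sub, sub_eq_zero] at h0
    rw [h0, ← hu']
    exact DFunLike.congr_fun hST u
  · rw [hS.norm_apply_eq_of_mul_self_eq hST, hu']
    exact T.range.norm_starProjection_apply_le z

/-- A vector which is the image under `K j ^ φ j` of a vector of norm at most `t ^ φ j * ‖y‖`
controls inner products through the powers of the limit of `K`. -/
theorem norm_inner_le_of_forall_exists_pow_apply_eq {E : Type*} [NormedAddCommGroup E]
    [InnerProductSpace ℂ E] [CompleteSpace E] {H : E →L[ℂ] E} {K : ℕ → E →L[ℂ] E} {φ : ℕ → ℕ}
    (hφ : Tendsto φ atTop atTop) (hK : ∀ j, IsSelfAdjoint (K j))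
    (hH : Tendsto K atTop (nhds H)) {y : E} {t : ℝ} (ht : 0 ≤ t)
    (hy : ∀ᶠ j in atTop, ∃ w, (K j ^ φ j) w = y ∧ ‖w‖ ≤ t ^ φ j * ‖y‖) (x : E) (k : ℕ) :
    ‖inner ℂ y x‖ ≤ t ^ k * ‖y‖ * ‖(H ^ k) x‖ := by
  have hlim : Tendsto (fun j => ‖(K j ^ k) x‖) atTop (nhds ‖(H ^ k) x‖) :=
    ((ContinuousLinearMap.apply ℂ E x).continuous.tendsto _ |>.comp (hH.pow k)).norm
  refine ge_of_tendsto (hlim.const_mul _) ?_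
  filter_upwards [hy, hφ.eventually (eventually_ge_atTop k),
    hφ.eventually (eventually_gt_atTop 0)] with j ⟨w, hw, hwn⟩ hkj h0
  have hv : (K j ^ k) ((K j ^ (φ j - k)) w) = y := by
    rw [← mul_apply_eq_comp, ← pow_add, Nat.add_sub_cancel' hkj, hw]
  have hvn : ‖(K j ^ (φ j - k)) w‖ ≤ t ^ k * ‖y‖ := by
    refine (pow_le_pow_iff_left₀ (norm_nonneg _) (by positivity) h0.ne').1 ?_
    calc ‖(K j ^ (φ j - k)) w‖ ^ φ j
        ≤ ‖(K j ^ φ j) w‖ ^ (φ j - k) * ‖w‖ ^ (φ j - (φ j - k)) :=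
          (hK j).norm_pow_apply_pow_le w (Nat.sub_le _ _)
      _ ≤ ‖y‖ ^ (φ j - k) * (t ^ φ j * ‖y‖) ^ k := by
          rw [hw, Nat.sub_sub_self hkj]
          gcongr
      _ = (t ^ φ j) ^ k * (‖y‖ ^ (φ j - k) * ‖y‖ ^ k) := by ring
      _ = (t ^ k * ‖y‖) ^ φ j := by
          rw [← pow_add, Nat.sub_add_cancel hkj]
          ring
  rw [← hv, (hK j).inner_pow_apply, hv]
  exact (norm_inner_le_norm _ _).trans (by gcongr)

/-- The function `f` applied to the diagonalized matrix `P * diagonal d * P⁻¹`. -/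
noncomputable def diagApply {m : ℕ} (P : Matrix (Fin m) (Fin m) ℂ) (d : Fin m → ℂ) (f : ℂ → ℂ) :
    Matrix (Fin m) (Fin m) ℂ :=
  P * diagonal (fun i => f (d i)) * P⁻¹

theorem diagApply_mul {m : ℕ} {P : Matrix (Fin m) (Fin m) ℂ} (hP : IsUnit P) (d : Fin m → ℂ)
    (f g : ℂ → ℂ) :
    diagApply P d f * diagApply P d g = diagApply P d (fun z => f z * g z) := by
  have h : P⁻¹ * P = 1 := nonsing_inv_mul P ((isUnit_iff_isUnit_det P).1 hP)
  unfold diagApply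
  rw [← diagonal_mul_diagonal]
  calc _ = P * diagonal (fun i => f (d i)) * (P⁻¹ * P) * diagonal (fun i => g (d i)) * P⁻¹ := by
        simp only [mul_assoc]
    _ = _ := by rw [h]; simp only [mul_assoc, one_mul]

theorem commute_diagApply {m : ℕ} {P : Matrix (Fin m) (Fin m) ℂ} (hP : IsUnit P) (d : Fin m → ℂ)
    {N : Matrix (Fin m) (Fin m) ℂ} (hN : Commute (P * diagonal d * P⁻¹) N) (f : ℂ → ℂ) :
    Commute (diagApply P d f) N := by
  have hdet := (isUnit_iff_isUnit_det P).1 hP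
  have h : P⁻¹ * P = 1 := nonsing_inv_mul P hdet
  have h' : P * P⁻¹ = 1 := mul_nonsing_inv P hdet
  obtain ⟨M, hNM⟩ : ∃ M, N = P * M * P⁻¹ := by
    refine ⟨P⁻¹ * N * P, ?_⟩
    calc N = (P * P⁻¹) * N * (P * P⁻¹) := by rw [h', one_mul, mul_one]
      _ = P * (P⁻¹ * N * P) * P⁻¹ := by simp only [mul_assoc]
  have key : ∀ X Y : Matrix (Fin m) (Fin m) ℂ,
      (P * X * P⁻¹) * (P * Y * P⁻¹) = P * (X * Y) * P⁻¹ := fun X Y => by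
    calc _ = P * X * (P⁻¹ * P) * Y * P⁻¹ := by simp only [mul_assoc]
      _ = _ := by rw [h]; simp only [mul_assoc, one_mul]
  have hcomm : diagonal d * M = M * diagonal d := by
    have h1 : P * (diagonal d * M) * P⁻¹ = P * (M * diagonal d) * P⁻¹ := by
      rw [← key, ← key, ← hNM]
      exact hN
    have h2 := congrArg (fun X => P⁻¹ * X * P) h1
    calc _ = P⁻¹ * P * (diagonal d * M) * (P⁻¹ * P) := by rw [h, one_mul, mul_one]
      _ = P⁻¹ * P * (M * diagonal d) * (P⁻¹ * P) := by simpa only [mul_assoc] using h2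
      _ = _ := by rw [h, one_mul, mul_one]
  have hcomm' : diagonal (fun i => f (d i)) * M = M * diagonal (fun i => f (d i)) := by
    ext i j
    have hij := congrFun (congrFun hcomm i) j
    rw [diagonal_mul, mul_diagonal] at hij ⊢
    rcases eq_or_ne (M i j) 0 with h0 | h0
    · simp [h0]
    · rw [mul_comm, mul_left_cancel₀ h0 ((mul_comm _ _).trans hij)]
  rw [hNM]
  unfold diagApply
  rw [Commute, SemiconjBy, key, key, hcomm']

theorem exists_eq_of_mem_spectrum_diagApply {m : ℕ} {P : Matrix (Fin m) (Fin m) ℂ} (hP : IsUnit P)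
    (d : Fin m → ℂ) (f : ℂ → ℂ) {z : ℂ} (hz : z ∈ spectrum ℂ (diagApply P d f)) :
    ∃ i, f (d i) = z := by
  obtain ⟨u, rfl⟩ := hP
  rw [diagApply, ← coe_units_inv, spectrum.units_conjugate, spectrum_diagonal] at hz
  exact hz

theorem diagApply_mulVec_of_eigenvector {m : ℕ} {P : Matrix (Fin m) (Fin m) ℂ} (hP : IsUnit P)
    (d : Fin m → ℂ) (f : ℂ → ℂ) {x : Fin m → ℂ} {c : ℂ}
    (hx : (P * diagonal d * P⁻¹) *ᵥ x = c • x) : diagApply P d f *ᵥ x = f c • x := by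
  have hdet := (isUnit_iff_isUnit_det P).1 hP
  have h : P⁻¹ * P = 1 := nonsing_inv_mul P hdet
  have h' : P * P⁻¹ = 1 := mul_nonsing_inv P hdet
  have h1 : diagonal d *ᵥ (P⁻¹ *ᵥ x) = c • (P⁻¹ *ᵥ x) := by
    have := congrArg (fun v => P⁻¹ *ᵥ v) hx
    simp only [mulVec_mulVec, mulVec_smul, ← mul_assoc, h, one_mul] at this
    rw [mulVec_mulVec, this]
  have h2 : diagonal (fun i => f (d i)) *ᵥ (P⁻¹ *ᵥ x) = f c • (P⁻¹ *ᵥ x) := by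
    ext i
    have hi := congrFun h1 i
    simp only [mulVec_diagonal, Pi.smul_apply, smul_eq_mul] at hi ⊢
    rcases eq_or_ne ((P⁻¹ *ᵥ x) i) 0 with h0 | h0
    · simp [h0]
    · rw [mul_right_cancel₀ h0 hi]
  rw [diagApply, ← mulVec_mulVec, ← mulVec_mulVec, h2, mulVec_smul, mulVec_mulVec, h', one_mulVec]

/-- Every `z` in the spectrum of `diagApply P d f + N`, with `N` nilpotent and commuting, is one of
the values of `f`. -/
theorem exists_eq_of_mem_spectrum_diagApply_add {m : ℕ} {P : Matrix (Fin m) (Fin m) ℂ}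
    (hP : IsUnit P) (d : Fin m → ℂ) (f : ℂ → ℂ) {N : Matrix (Fin m) (Fin m) ℂ}
    (hN : IsNilpotent N) (hcomm : Commute (diagApply P d f) N) {z : ℂ}
    (hz : z ∈ spectrum ℂ (diagApply P d f + N)) : ∃ i, f (d i) = z :=
  exists_eq_of_mem_spectrum_diagApply hP d f (spectrum_add_subset_of_isNilpotent hN hcomm hz)

theorem isSelfAdjoint_absPow {m : ℕ} (T : Matrix (Fin m) (Fin m) ℂ) (p : ℝ) :
    IsSelfAdjoint (absPow T p) :=
  cfc_predicate _ _

open scoped ComplexOrder in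
theorem absPow_one_div_pow {m : ℕ} (T : Matrix (Fin m) (Fin m) ℂ) {n : ℕ} (hn : 0 < n) :
    absPow T (1 / (n : ℝ)) ^ n * absPow T (1 / (n : ℝ)) ^ n = Tᴴ * T := by
  have hT : (Tᴴ * T).PosSemidef := posSemidef_conjTranspose_mul_self T
  have hsa : IsSelfAdjoint (Tᴴ * T) := hT.isHermitian
  rw [← pow_add, absPow, ← cfc_pow _ _ _
    ((Real.continuous_rpow_const (by positivity)).continuousOn) hsa]
  conv_rhs => rw [← cfc_id ℝ (Tᴴ * T) hsa]
  refine cfc_congr fun x hx => ?_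
  have hx0 : 0 ≤ x := hT.isHermitian.spectrum_real_eq_range_eigenvalues ▸ hx |>.elim
    fun i hi => hi ▸ hT.eigenvalues_nonneg i
  have hn' : (n : ℝ) ≠ 0 := by exact_mod_cast hn.ne'
  simp only [id]
  rw [← Real.rpow_natCast, ← Real.rpow_mul hx0]
  convert Real.rpow_one x using 2
  push_cast
  field_simp
  norm_num

/-- The span of the eigenvectors of `D` whose eigenvalues have modulus at most `r`. -/
noncomputable def eigenspan {m : ℕ} (D : Matrix (Fin m) (Fin m) ℂ) (r : ℝ) :
    Submodule ℂ (EuclideanSpace ℂ (Fin m)) :=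
  Submodule.span ℂ {x : EuclideanSpace ℂ (Fin m) |
    x ≠ 0 ∧ ∃ lam : ℂ, ‖lam‖ ≤ r ∧ toEuclideanCLM (𝕜 := ℂ) D x = lam • x}

theorem diagApply_apply_of_mem_eigenspan {m : ℕ} {P : Matrix (Fin m) (Fin m) ℂ} (hP : IsUnit P)
    (d : Fin m → ℂ) {r : ℝ} {f : ℂ → ℂ} (hf : ∀ z, ‖z‖ ≤ r → f z = 1)
    {x : EuclideanSpace ℂ (Fin m)} (hx : x ∈ eigenspan (P * diagonal d * P⁻¹) r) :
    toEuclideanCLM (𝕜 := ℂ) (diagApply P d f) x = x := by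
  induction hx using Submodule.span_induction with
  | mem x hx =>
    obtain ⟨-, c, hc, hx⟩ := hx
    have h : (P * diagonal d * P⁻¹) *ᵥ x.ofLp = c • x.ofLp := congrArg WithLp.ofLp hx
    have h2 := diagApply_mulVec_of_eigenvector hP d f h
    rw [hf c hc, one_smul] at h2
    exact WithLp.ofLp_injective 2 h2
  | zero => simp
  | add x y _ _ hx hy => rw [map_add, hx, hy]
  | smul c x _ hx => rw [map_smul, hx]

theorem diagApply_apply_mem_eigenspan {m : ℕ} {P : Matrix (Fin m) (Fin m) ℂ} (hP : IsUnit P)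
    (d : Fin m → ℂ) {r : ℝ} {f : ℂ → ℂ} (hf : ∀ z, r < ‖z‖ → f z = 0)
    (x : EuclideanSpace ℂ (Fin m)) :
    toEuclideanCLM (𝕜 := ℂ) (diagApply P d f) x ∈ eigenspan (P * diagonal d * P⁻¹) r := by
  have h : P⁻¹ * P = 1 := nonsing_inv_mul P ((isUnit_iff_isUnit_det P).1 hP)
  have hsum : toEuclideanCLM (𝕜 := ℂ) (diagApply P d f) x =
      ∑ i, (f (d i) * (P⁻¹ *ᵥ x.ofLp) i) •
        WithLp.toLp 2 (P *ᵥ (Pi.single i 1 : Fin m → ℂ)) := by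
    refine WithLp.ofLp_injective 2 ?_
    rw [ofLp_toEuclideanCLM, WithLp.ofLp_sum]
    simp only [WithLp.ofLp_smul, ← mulVec_smul]
    rw [← mulVec_sum, diagApply, ← mulVec_mulVec, ← mulVec_mulVec]
    congr 1
    ext j
    simp [mulVec_diagonal, Finset.sum_apply, Pi.single_apply]
  rw [hsum]
  refine Submodule.sum_mem _ fun i _ => ?_
  rcases lt_or_ge r ‖d i‖ with hi | hi
  · simp [hf _ hi]
  · refine Submodule.smul_mem _ _ ?_
    by_cases h0 : WithLp.toLp 2 (P *ᵥ (Pi.single i 1 : Fin m → ℂ)) = 0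
    · rw [h0]
      exact Submodule.zero_mem _
    · refine Submodule.subset_span ⟨h0, d i, hi, ?_⟩
      refine WithLp.ofLp_injective 2 ?_
      rw [ofLp_toEuclideanCLM, WithLp.ofLp_smul, mulVec_mulVec, mul_assoc, h, mul_one,
        ← mulVec_mulVec, ← mulVec_smul]
      congr 1
      ext j
      rcases eq_or_ne j i with rfl | hj <;> simp_all [mulVec_diagonal]

/-- Orbits of `D + N` starting in the span of the eigenvectors of `D` with eigenvalues of modulus
at most `r` grow at rate at most `r`. -/
theorem eventually_norm_pow_apply_le_of_mem_eigenspan {m : ℕ} {P : Matrix (Fin m) (Fin m) ℂ}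
    (hP : IsUnit P) (d : Fin m → ℂ) {N : Matrix (Fin m) (Fin m) ℂ} (hN : IsNilpotent N)
    (hcomm : Commute (P * diagonal d * P⁻¹) N) {r s : ℝ} (hr : 0 ≤ r) (hrs : r < s)
    {x : EuclideanSpace ℂ (Fin m)} (hx : x ∈ eigenspan (P * diagonal d * P⁻¹) r) :
    ∀ᶠ n : ℕ in atTop,
      ‖(toEuclideanCLM (𝕜 := ℂ) (P * diagonal d * P⁻¹ + N) ^ n) x‖ ≤ s ^ n := by
  set D := P * diagonal d * P⁻¹ with hD
  have hDid : diagApply P d id = D := rfl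
  set q : ℂ → ℂ := fun z => if ‖z‖ ≤ r then 1 else 0 with hq
  set Q := diagApply P d q with hQ
  have hQN : Commute Q N := commute_diagApply hP d hcomm q
  have hDQ : D * Q = diagApply P d (fun z => z * q z) := diagApply_mul hP d id q
  have hQD : Commute Q D := by
    rw [Commute, SemiconjBy, hDQ, ← hDid, diagApply_mul hP]
    simp [mul_comm]
  have hQA : Commute (D + N) Q := (hQD.add_right hQN).symm
  have hfix : toEuclideanCLM (𝕜 := ℂ) Q x = x :=
    diagApply_apply_of_mem_eigenspan hP d (by simp +contextual [hq]) hx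
  have hfixn : ∀ n : ℕ, (toEuclideanCLM (𝕜 := ℂ) Q ^ n) x = x := fun n => by
    induction n with
    | zero => simp
    | succ n ih => rw [pow_succ, mul_apply_eq_comp, hfix, ih]
  have hnil : IsNilpotent (N * Q) := hQN.symm.isNilpotent_mul_right hN
  have hcomm' : Commute (diagApply P d fun z => z * q z) (N * Q) :=
    (commute_diagApply hP d hcomm _).mul_right
      (hDQ ▸ (hQD.symm.mul_left (Commute.refl Q)))
  obtain ⟨t, hrt, hts⟩ := exists_between hrs
  have hgrowth : ∀ᶠ n : ℕ in atTop, ‖toEuclideanCLM (𝕜 := ℂ) ((D + N) * Q) ^ n‖ ≤ t ^ n := by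
    refine eventually_norm_pow_le_of_spectrum _ hr hrt fun z hz => ?_
    rw [AlgEquiv.spectrum_eq (toEuclideanCLM (n := Fin m) (𝕜 := ℂ)), add_mul, hDQ] at hz
    obtain ⟨i, rfl⟩ := exists_eq_of_mem_spectrum_diagApply_add hP d _ hnil hcomm' hz
    by_cases hi : ‖d i‖ ≤ r <;> simp [hq, hi, hr]
  filter_upwards [hgrowth, eventually_mul_pow_le_pow ‖x‖ (hr.trans hrt.le) hts] with n hn hn'
  have heq : (toEuclideanCLM (𝕜 := ℂ) (D + N) ^ n) x =
      (toEuclideanCLM (𝕜 := ℂ) ((D + N) * Q) ^ n) x := by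
    rw [← map_pow, ← map_pow, hQA.mul_pow, map_mul, mul_apply_eq_comp, map_pow _ Q, hfixn]
  rw [heq]
  calc _ ≤ ‖toEuclideanCLM (𝕜 := ℂ) ((D + N) * Q) ^ n‖ * ‖x‖ :=
        ContinuousLinearMap.le_opNorm _ _
    _ ≤ t ^ n * ‖x‖ := by gcongr
    _ ≤ s ^ n := by rwa [mul_comm]

/-- Vectors orthogonal to the span of the eigenvectors of `D` with eigenvalues of modulus at most
`r` have small preimages under the powers of the adjoint of `D + N`. -/
theorem exists_eventually_adjoint_pow_apply_eq {m : ℕ} {P : Matrix (Fin m) (Fin m) ℂ}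
    (hP : IsUnit P) (d : Fin m → ℂ) {N : Matrix (Fin m) (Fin m) ℂ} (hN : IsNilpotent N)
    (hcomm : Commute (P * diagonal d * P⁻¹) N) {r : ℝ} (hr : 0 ≤ r) :
    ∃ s > r, ∀ y ∈ (eigenspan (P * diagonal d * P⁻¹) r)ᗮ, ∀ᶠ n : ℕ in atTop,
      ∃ z, star (toEuclideanCLM (𝕜 := ℂ) (P * diagonal d * P⁻¹ + N) ^ n) z = y ∧
        ‖z‖ ≤ s⁻¹ ^ n * ‖y‖ := by
  obtain ⟨s', hs'd, hrs'⟩ : ∃ s', (∀ i, r < ‖d i‖ → s' ≤ ‖d i‖) ∧ r < s' := by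
    have h : ∀ᶠ s' in nhdsWithin r (Set.Ioi r), ∀ i, r < ‖d i‖ → s' ≤ ‖d i‖ := by
      rw [eventually_all]
      intro i
      by_cases hi : r < ‖d i‖
      · filter_upwards [nhdsWithin_le_nhds (eventually_le_nhds hi)] with s' hs' _ using hs'
      · simp [hi]
    exact (h.and self_mem_nhdsWithin).exists
  obtain ⟨s, hrs, hss'⟩ := exists_between hrs'
  have hs0 : 0 < s := hr.trans_lt hrs
  have hs'0 : 0 < s' := hs0.trans hss'
  refine ⟨s, hrs, fun y hy => ?_⟩
  set D := P * diagonal d * P⁻¹ with hD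
  have hDid : diagApply P d id = D := rfl
  set q : ℂ → ℂ := fun z => if ‖z‖ ≤ r then 1 else 0 with hq
  set g : ℂ → ℂ := fun z => if ‖z‖ ≤ r then (s' : ℂ) else z with hg
  set Q := diagApply P d (fun z => 1 - q z) with hQ
  set G := diagApply P d g with hG
  have hQN : Commute Q N := commute_diagApply hP d hcomm _
  have hGQ : G * Q = D * Q := by
    rw [hG, hQ, ← hDid, diagApply_mul hP, diagApply_mul hP]
    congr 1
    ext z
    by_cases hz : ‖z‖ ≤ r <;> simp [hq, hg, hz]
  have hQD : Commute Q D := by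
    rw [Commute, SemiconjBy, ← hDid, hQ, diagApply_mul hP, diagApply_mul hP]
    simp [mul_comm]
  have hQG : Commute Q G := by
    rw [Commute, SemiconjBy, hG, hQ, diagApply_mul hP, diagApply_mul hP]
    simp [mul_comm]
  have hQA : Commute Q (D + N) := hQD.add_right hQN
  have hspec : ∀ z ∈ spectrum ℂ (G + N), s' ≤ ‖z‖ := fun z hz => by
    obtain ⟨i, rfl⟩ := exists_eq_of_mem_spectrum_diagApply_add hP d g hN
      (commute_diagApply hP d hcomm g) hz
    by_cases hi : ‖d i‖ ≤ r
    · simp [hg, hi, le_abs_self]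
    · simpa [hg, hi] using hs'd i (not_le.1 hi)
  obtain ⟨u, hu⟩ : IsUnit (G + N) := by
    refine spectrum.isUnit_of_zero_notMem ℂ fun h0 => ?_
    have := hspec 0 h0
    rw [norm_zero] at this
    exact absurd hs'0 this.not_gt
  have hgrowth : ∀ᶠ n : ℕ in atTop,
      ‖toEuclideanCLM (𝕜 := ℂ) (↑u⁻¹ : Matrix (Fin m) (Fin m) ℂ) ^ n‖ ≤ s⁻¹ ^ n := by
    refine eventually_norm_pow_le_of_spectrum _ (inv_nonneg.2 hs'0.le)
      (inv_strictAnti₀ hs0 hss') fun z hz => ?_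
    rw [AlgEquiv.spectrum_eq (toEuclideanCLM (n := Fin m) (𝕜 := ℂ)), ← spectrum.map_inv, hu,
      Set.mem_inv] at hz
    have h := hspec _ hz
    rw [norm_inv] at h
    exact (le_inv_comm₀ hs'0 (inv_pos.1 (hs'0.trans_le h))).1 h
  have hQu : Commute Q (↑u⁻¹ : Matrix (Fin m) (Fin m) ℂ) :=
    (show Commute Q (u : Matrix (Fin m) (Fin m) ℂ) from hu ▸ hQG.add_right hQN).units_inv_right
  have hpow : ∀ n : ℕ, (u : Matrix (Fin m) (Fin m) ℂ) ^ n * Q = (D + N) ^ n * Q := fun n => by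
    induction n with
    | zero => simp
    | succ n ih =>
      rw [pow_succ', pow_succ', mul_assoc, ih, mul_assoc, ← (hQA.pow_right n).eq, ← mul_assoc,
        ← mul_assoc, hu, add_mul G, hGQ, ← add_mul D]
  have hQfac : ∀ n : ℕ, Q * (↑u⁻¹ : Matrix (Fin m) (Fin m) ℂ) ^ n * (D + N) ^ n = Q := fun n => by
    rw [(hQu.pow_right n).eq, mul_assoc, (hQA.pow_right n).eq, ← hpow, ← mul_assoc,
      ← Units.val_pow_eq_pow_val, ← Units.val_pow_eq_pow_val, inv_pow, Units.inv_mul, one_mul]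
  have hQy : star (toEuclideanCLM (𝕜 := ℂ) Q) y = y := by
    have hsub : Q = 1 - diagApply P d q := by
      have h1 : (1 : Matrix (Fin m) (Fin m) ℂ) = diagApply P d (fun _ => 1) := by
        rw [diagApply, diagonal_one, mul_one,
          mul_nonsing_inv P ((isUnit_iff_isUnit_det P).1 hP)]
      rw [h1, hQ]
      unfold diagApply
      rw [← sub_mul, ← mul_sub, diagonal_sub]
    have h0 : star (toEuclideanCLM (𝕜 := ℂ) (diagApply P d q)) y = 0 := by
      refine ext_inner_right ℂ fun v => ?_
      rw [ContinuousLinearMap.star_eq_adjoint, ContinuousLinearMap.adjoint_inner_left,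
        inner_zero_left]
      exact (Submodule.mem_orthogonal' _ _).1 hy _
        (diagApply_apply_mem_eigenspan hP d (fun z hz => by simp [hq, hz]) v)
    rw [hsub, ← map_star, star_sub, star_one, map_sub, map_one, map_star,
      _root_.sub_apply, h0, sub_zero]
    rfl
  filter_upwards [hgrowth] with n hn
  refine ⟨star (toEuclideanCLM (𝕜 := ℂ) (↑u⁻¹ : Matrix (Fin m) (Fin m) ℂ) ^ n) y, ?_, ?_⟩
  · conv_rhs => rw [← hQy, ← hQfac n]
    conv_lhs => rw [← hQy]
    rw [map_mul, map_mul, star_mul, star_mul, map_pow, map_pow]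
    rfl
  · refine (ContinuousLinearMap.le_opNorm _ _).trans ?_
    rw [ContinuousLinearMap.star_eq_adjoint, LinearIsometryEquiv.norm_map]
    gcongr

/-- Let A = D + N be the Jordan-Chevalley decomposition of A ∈ M_m(ℂ), and let H be a limit
point of {|A^n|^{1/n}}. Then for every r ≥ 0, V(A, r) = V(H, r), and both equal the span of
the eigenvectors of D whose eigenvalues have modulus at most r, where
V(T, r) := { x : limsup ‖T^n x‖^{1/n} ≤ r }. -/
theorem V_eq_V_limit_point_eq_span_eigenvectors (m : ℕ)
    (A D N : Matrix (Fin m) (Fin m) ℂ) (hA : A = D + N)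
    (hD : ∃ (P : Matrix (Fin m) (Fin m) ℂ) (d : Fin m → ℂ),
      IsUnit P ∧ D = P * Matrix.diagonal d * P⁻¹)
    (hN : IsNilpotent N) (hDN : D * N = N * D)
    (H : Matrix (Fin m) (Fin m) ℂ) (φ : ℕ → ℕ) (hφ : StrictMono φ)
    (hH : Tendsto (fun j => absPow (A ^ φ j) (1 / (φ j : ℝ))) atTop (nhds H))
    (r : ℝ) (hr : 0 ≤ r) :
    {x : EuclideanSpace ℂ (Fin m) |
        limsup (fun n : ℕ =>
          ‖toEuclideanCLM (𝕜 := ℂ) (A ^ n) x‖ ^ (1 / (n : ℝ))) atTop ≤ r} =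
      {x : EuclideanSpace ℂ (Fin m) |
        limsup (fun n : ℕ =>
          ‖toEuclideanCLM (𝕜 := ℂ) (H ^ n) x‖ ^ (1 / (n : ℝ))) atTop ≤ r} ∧
    {x : EuclideanSpace ℂ (Fin m) |
        limsup (fun n : ℕ =>
          ‖toEuclideanCLM (𝕜 := ℂ) (A ^ n) x‖ ^ (1 / (n : ℝ))) atTop ≤ r} =
      ↑(Submodule.span ℂ {x : EuclideanSpace ℂ (Fin m) |
          x ≠ 0 ∧ ∃ lam : ℂ, ‖lam‖ ≤ r ∧ toEuclideanCLM (𝕜 := ℂ) D x = lam • x}) := by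
  obtain ⟨P, d, hP, rfl⟩ := hD
  subst hA
  set A := P * diagonal d * P⁻¹ + N
  set L := toEuclideanCLM (n := Fin m) (𝕜 := ℂ) with hL
  have hφt : Tendsto φ atTop atTop := hφ.tendsto_atTop
  have hLc : Continuous L := (L.toAlgEquiv.toLinearMap).continuous_of_finiteDimensional
  have hKH : Tendsto (fun j => L (absPow (A ^ φ j) (1 / (φ j : ℝ)))) atTop (nhds (L H)) :=
    (hLc.tendsto H).comp hH
  have hKsa : ∀ j, IsSelfAdjoint (L (absPow (A ^ φ j) (1 / (φ j : ℝ)))) :=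
    fun j => (isSelfAdjoint_absPow _ _).map L
  have hKsq : ∀ᶠ j in atTop, L (absPow (A ^ φ j) (1 / (φ j : ℝ))) ^ φ j *
      L (absPow (A ^ φ j) (1 / (φ j : ℝ))) ^ φ j = star (L A ^ φ j) * L A ^ φ j := by
    filter_upwards [hφt.eventually (eventually_gt_atTop 0)] with j hj
    rw [← map_pow, ← map_mul, absPow_one_div_pow _ hj, map_mul, ← star_eq_conjTranspose,
      map_star, map_pow]
  have hAH : ∀ x : EuclideanSpace ℂ (Fin m),
      (∀ s > r, ∀ᶠ n : ℕ in atTop, ‖(L A ^ n) x‖ ≤ s ^ n) →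
      ∀ s > r, ∀ᶠ n : ℕ in atTop, ‖(L H ^ n) x‖ ≤ s ^ n := by
    intro x hx s hs
    obtain ⟨t, hrt, hts⟩ := exists_between hs
    filter_upwards [eventually_mul_pow_le_pow (max 1 ‖x‖) (hr.trans hrt.le) hts] with n hn
    refine (norm_limit_pow_apply_le hφt hKsa ?_ hKH (hr.trans hrt.le) (hx t hrt) n).trans hn
    filter_upwards [hKsq] with j hj x
    exact ((hKsa j).pow _).norm_apply_eq_of_mul_self_eq hj x
  have hHW : ∀ x : EuclideanSpace ℂ (Fin m),
      (∀ s > r, ∀ᶠ n : ℕ in atTop, ‖(L H ^ n) x‖ ≤ s ^ n) →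
      x ∈ eigenspan (P * diagonal d * P⁻¹) r := by
    intro x hx
    obtain ⟨s, hrs, hs⟩ := exists_eventually_adjoint_pow_apply_eq hP d hN hDN hr
    have hs0 : 0 < s := hr.trans_lt hrs
    obtain ⟨t, hrt, hts⟩ := exists_between hrs
    have ht0 : 0 < t := hr.trans_lt hrt
    rw [← Submodule.orthogonal_orthogonal (eigenspan _ r), Submodule.mem_orthogonal]
    intro y hy
    have hbound := norm_inner_le_of_forall_exists_pow_apply_eq hφt hKsa hKH (y := y)
      (inv_nonneg.2 hs0.le) (by
        filter_upwards [hKsq, hφt.eventually (hs y hy)] with j hj ⟨z, hz, hzn⟩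
        obtain ⟨w, hw, hwn⟩ := exists_apply_eq_adjoint_apply ((hKsa j).pow _) hj z
        exact ⟨w, hw.trans hz, hwn.trans hzn⟩) x
    have hlim : Tendsto (fun k : ℕ => ‖y‖ * (t / s) ^ k) atTop (nhds (‖y‖ * 0)) :=
      (tendsto_pow_atTop_nhds_zero_of_lt_one (by positivity)
        ((div_lt_one hs0).2 hts)).const_mul _
    rw [mul_zero] at hlim
    refine norm_le_zero_iff.1 (ge_of_tendsto hlim ?_)
    filter_upwards [hx t hrt] with k hk
    calc ‖inner ℂ y x‖ ≤ s⁻¹ ^ k * ‖y‖ * ‖(L H ^ k) x‖ := hbound k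
      _ ≤ s⁻¹ ^ k * ‖y‖ * t ^ k := by gcongr
      _ = ‖y‖ * (t / s) ^ k := by rw [div_pow, inv_pow]; ring
  have hWA : ∀ x ∈ eigenspan (P * diagonal d * P⁻¹) r,
      ∀ s > r, ∀ᶠ n : ℕ in atTop, ‖(L A ^ n) x‖ ≤ s ^ n :=
    fun x hx s hs => eventually_norm_pow_apply_le_of_mem_eigenspan hP d hN hDN hr hs hx
  simp only [map_pow, limsup_norm_pow_apply_rpow_le_iff _ _ hr]
  constructor
  · ext x
    exact ⟨hAH x, fun hx => hWA x (hHW x hx)⟩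
  · ext x
    exact ⟨fun hx => hHW x (hAH x hx), hWA x⟩
end
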